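/- Let Γ be a connected finite simple graph on m ≥ 1 vertices and let N ≥ 2 be an integer. Then every integral singular homology group H_d(Conf_Γ(ℝ^N); ℤ) is a finitely generated free abelian group; H_d(Conf_Γ(ℝ^N); ℤ) = 0 unless d = (m−i)(N−1) for some integer 1 ≤ i ≤ m; and for each 1 ≤ i ≤ m the rank of H_{(m−i)(N−1)}(Conf_Γ(ℝ^N); ℤ) equals a_i (in particular a_i ≥ 0). Equivalently, the Poincaré polynomial Σ_d rank H_d(Conf_Γ(ℝ^N); ℤ)·t^d equals Σ_{i=1}^m a_i t^{(m−i)(N−1)} = (−1)^m t^{m(N−1)} χ_Γ(−t^{1−N}). -/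

import Mathlib

/-!
STATEMENT 0: For a connected finite simple graph Γ on m ≥ 1 vertices and N ≥ 2,
the integral homology of the chromatic configuration space Conf_Γ(ℝ^N) is free,
concentrated in degrees (m−i)(N−1) for 1 ≤ i ≤ m, with ranks given by the
(unsigned) coefficients of the chromatic polynomial of Γ.
-/

open CategoryTheory

/-- The singular chain complex of a topological space, followed by homology:
singular homology with integer coefficients, as a functor. -/
noncomputable def singularHomologyFunctor (d : ℕ) : TopCat ⥤ ModuleCat ℤ :=
  TopCat.toSSet ⋙ ((SimplicialObject.whiskering _ _).obj (ModuleCat.free ℤ)) ⋙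
    AlgebraicTopology.alternatingFaceMapComplex (ModuleCat ℤ) ⋙
    HomologicalComplex.homologyFunctor (ModuleCat ℤ) (ComplexShape.down ℕ) d

/-- `SH d X` is the `d`-th integral singular homology group of `X`. -/
noncomputable abbrev SH (d : ℕ) (X : Type) [TopologicalSpace X] : ModuleCat ℤ :=
  (singularHomologyFunctor d).obj (TopCat.of X)

/-- The chromatic configuration space `Conf_Γ(ℝ^N)` of a simple graph `Γ` on
vertex set `Fin m`: tuples of points of `ℝ^N` indexed by the vertices, with
distinct values on adjacent vertices. -/
abbrev chromConf (N m : ℕ) (G : SimpleGraph (Fin m)) : Type :=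
  {x : Fin m → EuclideanSpace ℝ (Fin N) // ∀ i j, G.Adj i j → x i ≠ x j}

namespace SingularChains

section Chains

open Finset

/-- The standard topological `n`-simplex. -/
abbrev Simp (n : ℕ) : Type := stdSimplex ℝ (Fin (n + 1))

/-- The affine map between standard simplices with prescribed images of the vertices. -/
noncomputable def affine {k m : ℕ} (v : Fin (k + 1) → Simp m) : C(Simp k, Simp m) where
  toFun t := ⟨∑ i, t.1 i • (v i).1,
    (convex_stdSimplex ℝ (Fin (m + 1))).sum_mem (fun i _ => t.2.1 i) t.2.2 (fun i _ => (v i).2)⟩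
  continuous_toFun := by
    refine Continuous.subtype_mk ?_ _
    refine continuous_finsetSum _ fun i _ => ?_
    exact ((continuous_apply i).comp continuous_subtype_val).smul continuous_const

lemma affine_coe {k m : ℕ} (v : Fin (k + 1) → Simp m) (t : Simp k) :
    (affine v t).1 = ∑ i, t.1 i • (v i).1 := rfl

/-- The vertices of the standard simplex. -/
noncomputable abbrev vert {n : ℕ} (i : Fin (n + 1)) : Simp n := stdSimplex.vertex i

lemma vert_coe {n : ℕ} (i : Fin (n + 1)) :
    (vert i : Simp n).1 = Pi.single i 1 := rfl

@[simp] lemma affine_vert {k m : ℕ} (v : Fin (k + 1) → Simp m) (i : Fin (k + 1)) :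
    affine v (vert i) = v i := by
  apply Subtype.ext
  rw [affine_coe, vert_coe]
  rw [Finset.sum_eq_single i]
  · simp
  · intro j _ hj; simp [hj]
  · simp

lemma affine_affine {k l m : ℕ} (v : Fin (l + 1) → Simp m) (w : Fin (k + 1) → Simp l)
    (t : Simp k) : affine v (affine w t) = affine (fun i => affine v (w i)) t := by
  apply Subtype.ext
  simp only [affine_coe, Finset.sum_apply, Pi.smul_apply, smul_eq_mul, Finset.sum_smul,
    Finset.smul_sum, smul_smul]
  rw [Finset.sum_comm]

lemma affine_comp {k l m : ℕ} (v : Fin (l + 1) → Simp m) (w : Fin (k + 1) → Simp l) :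
    (affine v).comp (affine w) = affine (fun i => affine v (w i)) := by
  ext1 t; exact affine_affine v w t

@[simp] lemma affine_id {m : ℕ} : affine (vert : Fin (m + 1) → Simp m) = ContinuousMap.id _ := by
  ext1 t
  apply Subtype.ext
  rw [affine_coe]
  ext j
  simp [Finset.sum_apply, Pi.single_apply]

lemma affine_injective {k m : ℕ} :
    Function.Injective (affine : (Fin (k + 1) → Simp m) → C(Simp k, Simp m)) := by
  intro v w h
  ext1 i
  rw [← affine_vert v, h, affine_vert]

lemma dist_affine_le {k m : ℕ} (v : Fin (k + 1) → Simp m) (t : Simp k) (y : Simp m) (R : ℝ)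
    (h : ∀ i, dist (v i) y ≤ R) : dist (affine v t) y ≤ R := by
  have : (affine v t).1 ∈ Metric.closedBall y.1 R := by
    rw [affine_coe]
    exact (convex_closedBall _ _).sum_mem (fun i _ => t.2.1 i) t.2.2
      (fun i _ => h i)
  exact this

variable {X Y Z : Type} [TopologicalSpace X] [TopologicalSpace Y] [TopologicalSpace Z]

/-- Integral singular chains. -/
abbrev Chain (n : ℕ) (X : Type) [TopologicalSpace X] : Type := C(Simp n, X) →₀ ℤ

/-- The `i`-th face of a singular simplex. -/
noncomputable def face {n : ℕ} (i : Fin (n + 2)) (σ : C(Simp (n + 1), X)) : C(Simp n, X) :=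
  σ.comp (affine fun j => vert (i.succAbove j))

/-- The boundary of singular chains, out of positive degrees. -/
noncomputable def bdS (n : ℕ) : Chain (n + 1) X →ₗ[ℤ] Chain n X :=
  ∑ i : Fin (n + 2), (-1 : ℤ) ^ (i : ℕ) • Finsupp.lmapDomain ℤ ℤ (face i)

lemma bdS_single {n : ℕ} (σ : C(Simp (n + 1), X)) :
    bdS n (Finsupp.single σ 1) =
      ∑ i : Fin (n + 2), (-1 : ℤ) ^ (i : ℕ) • Finsupp.single (face i σ) 1 := by
  simp only [bdS, LinearMap.sum_apply, LinearMap.smul_apply, Finsupp.lmapDomain_apply,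
    Finsupp.mapDomain_single]

/-- The map on chains induced by a continuous map. -/
noncomputable def pushf (f : C(X, Y)) (n : ℕ) : Chain n X →ₗ[ℤ] Chain n Y :=
  Finsupp.lmapDomain ℤ ℤ f.comp

@[simp] lemma pushf_single (f : C(X, Y)) (n : ℕ) (σ : C(Simp n, X)) (a : ℤ) :
    pushf f n (Finsupp.single σ a) = Finsupp.single (f.comp σ) a := by
  simp [pushf]

lemma pushf_bdS (f : C(X, Y)) (n : ℕ) (c : Chain (n + 1) X) :
    pushf f n (bdS n c) = bdS n (pushf f (n + 1) c) := by
  suffices h : pushf f n ∘ₗ bdS n = bdS n ∘ₗ pushf f (n + 1) from LinearMap.congr_fun h c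
  ext σ : 2
  simp [bdS_single, face, ContinuousMap.comp_assoc]

/-- Affine chains in a standard simplex. -/
abbrev AffChain (k m : ℕ) : Type := (Fin (k + 1) → Simp m) →₀ ℤ

/-- The boundary of affine chains, out of positive degrees. -/
noncomputable def abd (k : ℕ) {m : ℕ} : AffChain (k + 1) m →ₗ[ℤ] AffChain k m :=
  ∑ i : Fin (k + 2), (-1 : ℤ) ^ (i : ℕ) • Finsupp.lmapDomain ℤ ℤ (fun v => v ∘ i.succAbove)

lemma abd_single {k m : ℕ} (v : Fin (k + 2) → Simp m) :
    abd k (Finsupp.single v 1) =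
      ∑ i : Fin (k + 2), (-1 : ℤ) ^ (i : ℕ) • Finsupp.single (v ∘ i.succAbove) 1 := by
  simp only [abd, LinearMap.sum_apply, LinearMap.smul_apply, Finsupp.lmapDomain_apply,
    Finsupp.mapDomain_single]

/-- The singular chain obtained by composing a singular simplex with an affine chain. -/
noncomputable def push {m : ℕ} (σ : C(Simp m, X)) (k : ℕ) : AffChain k m →ₗ[ℤ] Chain k X :=
  Finsupp.lmapDomain ℤ ℤ fun v => σ.comp (affine v)

@[simp] lemma push_single {m : ℕ} (σ : C(Simp m, X)) (k : ℕ) (v : Fin (k + 1) → Simp m) (a : ℤ) :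
    push σ k (Finsupp.single v a) = Finsupp.single (σ.comp (affine v)) a := by
  simp [push]

/-- The map on affine chains induced by an affine map. -/
noncomputable def amap {l m : ℕ} (u : Fin (l + 1) → Simp m) (k : ℕ) :
    AffChain k l →ₗ[ℤ] AffChain k m :=
  Finsupp.lmapDomain ℤ ℤ fun v i => affine u (v i)

@[simp] lemma amap_single {l m : ℕ} (u : Fin (l + 1) → Simp m) (k : ℕ)
    (v : Fin (k + 1) → Simp l) (a : ℤ) :
    amap u k (Finsupp.single v a) = Finsupp.single (fun i => affine u (v i)) a := by
  simp [amap]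

lemma push_amap {l m : ℕ} (σ : C(Simp m, X)) (u : Fin (l + 1) → Simp m) (k : ℕ)
    (c : AffChain k l) : push σ k (amap u k c) = push (σ.comp (affine u)) k c := by
  suffices h : push σ k ∘ₗ amap u k = push (σ.comp (affine u)) k from LinearMap.congr_fun h c
  ext v : 2
  simp [ContinuousMap.comp_assoc, affine_comp]

lemma bdS_push {m : ℕ} (σ : C(Simp m, X)) (k : ℕ) (c : AffChain (k + 1) m) :
    bdS k (push σ (k + 1) c) = push σ k (abd k c) := by
  suffices h : bdS k ∘ₗ push σ (k + 1) = push σ k ∘ₗ abd k from LinearMap.congr_fun h c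
  ext v : 2
  simp only [LinearMap.comp_apply, Finsupp.lsingle_apply, push_single, bdS_single, abd_single,
    map_sum, map_smul, face, ContinuousMap.comp_assoc, affine_comp, affine_vert]
  rfl

lemma amap_abd {l m : ℕ} (u : Fin (l + 1) → Simp m) (k : ℕ) (c : AffChain (k + 1) l) :
    amap u k (abd k c) = abd k (amap u (k + 1) c) := by
  suffices h : amap u k ∘ₗ abd k = abd k ∘ₗ amap u (k + 1) from LinearMap.congr_fun h c
  ext v : 2
  simp only [LinearMap.comp_apply, Finsupp.lsingle_apply, amap_single, abd_single,
    map_sum, map_smul]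
  rfl

end Chains

section Affine

open Finset Simplicial

variable {X Y Z : Type} [TopologicalSpace X] [TopologicalSpace Y] [TopologicalSpace Z]

/-- The functor of singular chain complexes underlying `singularHomologyFunctor`. -/
noncomputable def complexFunctor : TopCat.{0} ⥤ ChainComplex (ModuleCat.{0} ℤ) ℕ :=
  TopCat.toSSet ⋙ ((SimplicialObject.whiskering _ _).obj (ModuleCat.free ℤ)) ⋙
    AlgebraicTopology.alternatingFaceMapComplex (ModuleCat ℤ)

/-- The singular chain complex underlying `SH`. -/
noncomputable abbrev cpx (X : Type) [TopologicalSpace X] : ChainComplex (ModuleCat.{0} ℤ) ℕ :=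
  complexFunctor.obj (TopCat.of X)

/-- Singular simplices in the sense of `TopCat.toSSet`. -/
noncomputable abbrev simpEquiv (n : ℕ) (X : Type) [TopologicalSpace X] :
    (TopCat.toSSet.obj (TopCat.of X)).obj (Opposite.op ⦋n⦌) ≃ C(Simp n, X) :=
  TopCat.toSSetObjEquiv (TopCat.of X) (Opposite.op ⦋n⦌)

/-- Identification of the two models of singular chains. -/
noncomputable def chainEquiv (n : ℕ) (X : Type) [TopologicalSpace X] :
    ((cpx X).X n) ≃ₗ[ℤ] Chain n X :=
  Finsupp.domLCongr (simpEquiv n X)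

lemma simpEquiv_map (f : C(X, Y)) (n : ℕ)
    (s : (TopCat.toSSet.obj (TopCat.of X)).obj (Opposite.op ⦋n⦌)) :
    simpEquiv n Y ((TopCat.toSSet.map (TopCat.ofHom f)).app _ s) = f.comp (simpEquiv n X s) := rfl

lemma map_eq_affine {k m : ℕ} (f : Fin (k + 1) → Fin (m + 1)) (t : Simp k) :
    stdSimplex.map f t = affine (fun j => vert (f j)) t := by
  apply Subtype.ext
  rw [affine_coe]
  ext j
  rw [show (stdSimplex.map f t).1 = _ from stdSimplex.map_coe f t,
    FunOnFinite.linearMap_apply_apply]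
  simp only [Finset.sum_apply, Pi.smul_apply, smul_eq_mul, Pi.single_apply, mul_ite,
    mul_one, mul_zero]
  rw [Finset.sum_filter]
  refine Finset.sum_congr rfl fun i _ => ?_
  simp only [eq_comm]
  rfl

lemma simpEquiv_δ (n : ℕ) (i : Fin (n + 2))
    (s : (TopCat.toSSet.obj (TopCat.of X)).obj (Opposite.op ⦋n + 1⦌)) :
    simpEquiv n X ((TopCat.toSSet.obj (TopCat.of X)).δ i s) = face i (simpEquiv (n + 1) X s) := by
  ext1 t
  change simpEquiv (n + 1) X s (stdSimplex.map _ t) = _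
  rw [map_eq_affine]
  rfl

/-- The generator of the chain group given by a singular simplex. -/
noncomputable def gen (n : ℕ) (s : (TopCat.toSSet.obj (TopCat.of X)).obj (Opposite.op ⦋n⦌)) :
    (cpx X).X n :=
  (Finsupp.single s 1 : _ →₀ ℤ)

lemma chainEquiv_gen (n : ℕ) (s) :
    chainEquiv n X (gen n s) = Finsupp.single (simpEquiv n X s) 1 :=
  Finsupp.domLCongr_single _ _ _

lemma hom_ext_gen {n : ℕ} {M : Type} [AddCommGroup M] [Module ℤ M]
    {f g : (cpx X).X n →ₗ[ℤ] M} (h : ∀ s, f (gen n s) = g (gen n s)) : f = g :=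
  Finsupp.lhom_ext' fun s => LinearMap.ext_ring (h s)

lemma map_gen (f : C(X, Y)) (n : ℕ) (s) :
    (complexFunctor.map (TopCat.ofHom f)).f n (gen n s) =
      gen n ((TopCat.toSSet.map (TopCat.ofHom f)).app _ s) :=
  Finsupp.mapDomain_single

lemma objD_apply (S : SimplicialObject (ModuleCat.{0} ℤ)) (n : ℕ)
    (x : S.obj (Opposite.op ⦋n + 1⦌)) :
    (AlgebraicTopology.AlternatingFaceMapComplex.objD S n).hom x =
      ∑ i : Fin (n + 2), (-1 : ℤ) ^ (i : ℕ) • (S.δ i).hom x := by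
  simp only [AlgebraicTopology.AlternatingFaceMapComplex.objD, ModuleCat.hom_sum,
    LinearMap.sum_apply, ModuleCat.hom_zsmul]
  rfl

lemma d_gen (n : ℕ) (s) :
    (cpx X).d (n + 1) n (gen (n + 1) s) =
      ∑ i : Fin (n + 2), (-1 : ℤ) ^ (i : ℕ) • gen n ((TopCat.toSSet.obj (TopCat.of X)).δ i s) := by
  have : (cpx X).d (n + 1) n = _ :=
    AlgebraicTopology.alternatingFaceMapComplex_obj_d _ _
  rw [this]
  refine (objD_apply _ n _).trans (Finset.sum_congr rfl fun i _ => congrArg _ ?_)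
  exact Finsupp.mapDomain_single

lemma chainEquiv_map (f : C(X, Y)) (n : ℕ) (x : (cpx X).X n) :
    chainEquiv n Y ((complexFunctor.map (TopCat.ofHom f)).f n x) =
      pushf f n (chainEquiv n X x) := by
  suffices h : (chainEquiv n Y).toLinearMap ∘ₗ ((complexFunctor.map (TopCat.ofHom f)).f n).hom =
      pushf f n ∘ₗ (chainEquiv n X).toLinearMap from LinearMap.congr_fun h x
  refine hom_ext_gen fun s => ?_
  simp only [LinearMap.comp_apply, LinearEquiv.coe_coe, chainEquiv_gen, pushf_single,
    map_gen, simpEquiv_map]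

lemma chainEquiv_d (n : ℕ) (x : (cpx X).X (n + 1)) :
    chainEquiv n X ((cpx X).d (n + 1) n x) = bdS n (chainEquiv (n + 1) X x) := by
  suffices h : (chainEquiv n X).toLinearMap ∘ₗ ((cpx X).d (n + 1) n).hom =
      bdS n ∘ₗ (chainEquiv (n + 1) X).toLinearMap from LinearMap.congr_fun h x
  refine hom_ext_gen fun s => ?_
  simp only [LinearMap.comp_apply, LinearEquiv.coe_coe, chainEquiv_gen, d_gen, map_sum,
    bdS_single]
  refine Finset.sum_congr rfl fun i _ => ?_
  refine (map_zsmul (chainEquiv n X) _ _).trans ?_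
  rw [chainEquiv_gen, simpEquiv_δ]

lemma bdS_bdS (n : ℕ) (c : Chain (n + 2) X) : bdS n (bdS (n + 1) c) = 0 := by
  obtain ⟨x, rfl⟩ := (chainEquiv (n + 2) X).surjective c
  rw [← chainEquiv_d, ← chainEquiv_d, ← ModuleCat.comp_apply, HomologicalComplex.d_comp_d]
  simp

end Affine

section Subdivision

open Finset

variable {X Y Z : Type} [TopologicalSpace X] [TopologicalSpace Y] [TopologicalSpace Z]

lemma push_id_injective {k m : ℕ} :
    Function.Injective (push (ContinuousMap.id (Simp m)) k) :=
  Finsupp.mapDomain_injective affine_injective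

lemma abd_abd {k m : ℕ} (c : AffChain (k + 2) m) : abd k (abd (k + 1) c) = 0 := by
  apply push_id_injective
  rw [← bdS_push, ← bdS_push, bdS_bdS, map_zero]

/-- The cone on an affine chain. -/
noncomputable def cone {m : ℕ} (b : Simp m) (k : ℕ) : AffChain k m →ₗ[ℤ] AffChain (k + 1) m :=
  Finsupp.lmapDomain ℤ ℤ fun v => (Fin.cons b v : Fin (k + 2) → Simp m)

@[simp] lemma cone_single {k m : ℕ} (b : Simp m) (v : Fin (k + 1) → Simp m) (a : ℤ) :
    cone b k (Finsupp.single v a) =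
      Finsupp.single (Fin.cons b v : Fin (k + 2) → Simp m) a := by
  simp [cone]

lemma abd_cone {k m : ℕ} (b : Simp m) (c : AffChain (k + 1) m) :
    abd (k + 1) (cone b (k + 1) c) = c - cone b k (abd k c) := by
  suffices h : abd (k + 1) ∘ₗ cone b (k + 1) = LinearMap.id - cone b k ∘ₗ abd k from
    LinearMap.congr_fun h c
  ext v : 2
  simp only [LinearMap.comp_apply, Finsupp.lsingle_apply, cone_single, abd_single,
    LinearMap.sub_apply, LinearMap.id_apply, map_sum, map_smul]
  rw [Fin.sum_univ_succ, sub_eq_add_neg, ← Finset.sum_neg_distrib]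
  congr 1
  · simp [Function.comp_def]
  · refine Finset.sum_congr rfl fun i _ => ?_
    have : (Fin.cons b v : Fin (k + 3) → Simp m) ∘ i.succ.succAbove =
        (Fin.cons b (v ∘ i.succAbove) : Fin (k + 2) → Simp m) := by
      ext1 j
      refine Fin.cases ?_ (fun j => ?_) j <;> simp
    rw [this, Fin.val_succ, pow_succ]
    simp

lemma amap_cone {k l m : ℕ} (u : Fin (l + 1) → Simp m) (b : Simp l) (c : AffChain k l) :
    amap u (k + 1) (cone b k c) = cone (affine u b) k (amap u k c) := by
  suffices h : amap u (k + 1) ∘ₗ cone b k = cone (affine u b) k ∘ₗ amap u k from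
    LinearMap.congr_fun h c
  ext v : 2
  simp only [LinearMap.comp_apply, Finsupp.lsingle_apply, cone_single, amap_single]
  congr 1
  ext1 j
  refine Fin.cases ?_ (fun j => ?_) j <;> simp

/-- The barycenter of an affine simplex. -/
noncomputable def bary {k m : ℕ} (v : Fin (k + 1) → Simp m) : Simp m :=
  affine v stdSimplex.barycenter

/-- The chain homotopy from the identity to barycentric subdivision on affine chains. -/
noncomputable def subT (m : ℕ) : (k : ℕ) → (AffChain k m →ₗ[ℤ] AffChain (k + 1) m)
  | 0 => 0
  | k + 1 => Finsupp.linearCombination ℤ fun v =>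
      cone (bary v) (k + 1) (Finsupp.single v 1 - subT m k (abd k (Finsupp.single v 1)))

/-- Barycentric subdivision of affine chains. -/
noncomputable def sd (m : ℕ) : (k : ℕ) → (AffChain k m →ₗ[ℤ] AffChain k m)
  | 0 => LinearMap.id
  | k + 1 => LinearMap.id - abd (k + 1) ∘ₗ subT m (k + 1) - subT m k ∘ₗ abd k

lemma subT_single {k m : ℕ} (v : Fin (k + 2) → Simp m) :
    subT m (k + 1) (Finsupp.single v 1) =
      cone (bary v) (k + 1) (Finsupp.single v 1 - subT m k (abd k (Finsupp.single v 1))) := by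
  simp [subT]

lemma abd_subT {k m : ℕ} (c : AffChain (k + 1) m) :
    abd (k + 1) (subT m (k + 1) c) = c - sd m (k + 1) c - subT m k (abd k c) := by
  simp only [sd, LinearMap.sub_apply, LinearMap.comp_apply, LinearMap.id_apply]
  abel

lemma abd_subT_abd {k m : ℕ} (c : AffChain (k + 1) m) :
    abd k (subT m k (abd k c)) = abd k c - sd m k (abd k c) := by
  cases k with
  | zero => simp [subT, sd]
  | succ k => rw [abd_subT, abd_abd, map_zero, sub_zero]

lemma sd_single {k m : ℕ} (v : Fin (k + 2) → Simp m) :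
    sd m (k + 1) (Finsupp.single v 1) =
      cone (bary v) k (sd m k (abd k (Finsupp.single v 1))) := by
  have h := abd_subT (Finsupp.single v (1 : ℤ))
  rw [subT_single, abd_cone, map_sub, abd_subT_abd, sub_sub_cancel] at h
  rw [sub_right_comm (Finsupp.single v 1) (sd m (k + 1) _)] at h
  exact (sub_right_injective h).symm

lemma amap_subT {k l m : ℕ} (u : Fin (l + 1) → Simp m) (c : AffChain k l) :
    amap u (k + 1) (subT l k c) = subT m k (amap u k c) := by
  induction k with
  | zero => simp [subT]
  | succ k ih =>
    suffices h : amap u (k + 2) ∘ₗ subT l (k + 1) = subT m (k + 1) ∘ₗ amap u (k + 1) from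
      LinearMap.congr_fun h c
    ext v : 2
    simp only [LinearMap.comp_apply, Finsupp.lsingle_apply, amap_single, subT_single, amap_cone,
      map_sub, ih, amap_abd]
    simp only [bary, affine_affine]

lemma amap_sd {k l m : ℕ} (u : Fin (l + 1) → Simp m) (c : AffChain k l) :
    amap u k (sd l k c) = sd m k (amap u k c) := by
  cases k with
  | zero => simp [sd]
  | succ k =>
    simp only [sd, LinearMap.sub_apply, LinearMap.comp_apply, LinearMap.id_apply, map_sub,
      amap_subT, amap_abd]

/-- The subdivision homotopy on singular chains. -/
noncomputable def subTX (k : ℕ) : Chain k X →ₗ[ℤ] Chain (k + 1) X :=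
  Finsupp.linearCombination ℤ fun σ => push σ (k + 1) (subT k k (Finsupp.single vert 1))

/-- Barycentric subdivision of singular chains. -/
noncomputable def sdX (k : ℕ) : Chain k X →ₗ[ℤ] Chain k X :=
  Finsupp.linearCombination ℤ fun σ => push σ k (sd k k (Finsupp.single vert 1))

lemma subTX_push {k m : ℕ} (σ : C(Simp m, X)) (c : AffChain k m) :
    subTX k (push σ k c) = push σ (k + 1) (subT m k c) := by
  suffices h : subTX k ∘ₗ push σ k = push σ (k + 1) ∘ₗ subT m k from LinearMap.congr_fun h c
  ext v : 2
  simp [subTX, ← push_amap, amap_subT]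

lemma sdX_push {k m : ℕ} (σ : C(Simp m, X)) (c : AffChain k m) :
    sdX k (push σ k c) = push σ k (sd m k c) := by
  suffices h : sdX k ∘ₗ push σ k = push σ k ∘ₗ sd m k from LinearMap.congr_fun h c
  ext v : 2
  simp [sdX, ← push_amap, amap_sd]

lemma push_vert {k : ℕ} (σ : C(Simp k, X)) :
    push σ k (Finsupp.single vert 1) = Finsupp.single σ 1 := by
  simp

lemma bdS_subTX {k : ℕ} (c : Chain (k + 1) X) :
    bdS (k + 1) (subTX (k + 1) c) = c - sdX (k + 1) c - subTX k (bdS k c) := by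
  suffices h : bdS (k + 1) ∘ₗ subTX (k + 1) = (LinearMap.id - sdX (k + 1) - subTX k ∘ₗ bdS k :
    Chain (k + 1) X →ₗ[ℤ] Chain (k + 1) X) from LinearMap.congr_fun h c
  ext σ : 2
  simp only [LinearMap.comp_apply, Finsupp.lsingle_apply, LinearMap.sub_apply, LinearMap.id_apply]
  rw [← push_vert σ, subTX_push, bdS_push, bdS_push, sdX_push, subTX_push, abd_subT]
  simp only [map_sub]

end Subdivision

section SmallChains

open Finset

variable {X Y Z : Type} [TopologicalSpace X] [TopologicalSpace Y] [TopologicalSpace Z]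

lemma map_mem_of_mem_supported {α M : Type*} [AddCommGroup M] [Module ℤ M] {s : Set α}
    (N : Submodule ℤ M) (f : (α →₀ ℤ) →ₗ[ℤ] M) (h : ∀ a ∈ s, f (Finsupp.single a 1) ∈ N)
    {c : α →₀ ℤ} (hc : c ∈ Finsupp.supported ℤ ℤ s) : f c ∈ N := by
  rw [Finsupp.supported_eq_span_single] at hc
  have : Submodule.span ℤ ((fun i => Finsupp.single i (1 : ℤ)) '' s) ≤ N.comap f := by
    rw [Submodule.span_le]
    rintro _ ⟨a, ha, rfl⟩
    exact h a ha
  exact this hc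

lemma single_mem_supported {α : Type*} {s : Set α} {a : α} (h : a ∈ s) (n : ℤ) :
    Finsupp.single a n ∈ Finsupp.supported ℤ ℤ s :=
  Finsupp.single_mem_supported ℤ n h

/-- The affine simplices contained in every ball containing the vertices of `v`. -/
def hullSet {k l m : ℕ} (v : Fin (k + 1) → Simp m) : Set (Fin (l + 1) → Simp m) :=
  {w | ∀ (y : Simp m) (R : ℝ), (∀ j, dist (v j) y ≤ R) → ∀ i, dist (w i) y ≤ R}

/-- The affine simplices of diameter at most `D`. -/
def diamSet (k m : ℕ) (D : ℝ) : Set (Fin (k + 1) → Simp m) :=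
  {w | ∀ i j, dist (w i) (w j) ≤ D}

lemma sd_mem_hull {k m : ℕ} (v : Fin (k + 1) → Simp m) :
    sd m k (Finsupp.single v 1) ∈ Finsupp.supported ℤ ℤ (hullSet (l := k) v) := by
  induction k with
  | zero => exact single_mem_supported (fun y R h => h) 1
  | succ k ih =>
    rw [sd_single, abd_single, map_sum, map_sum]
    refine Submodule.sum_mem _ fun i _ => ?_
    rw [map_smul, map_smul]
    refine Submodule.smul_mem _ _ ?_
    refine map_mem_of_mem_supported _ _ (fun w hw => ?_) (ih (v ∘ i.succAbove))
    rw [cone_single]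
    refine single_mem_supported (fun y R h j => ?_) 1
    refine Fin.cases ?_ (fun j => ?_) j
    · exact dist_affine_le _ _ _ _ h
    · exact hw y R (fun j => h _) j

lemma dist_bary_le {k m : ℕ} (v : Fin (k + 1) → Simp m) {D : ℝ}
    (hv : v ∈ diamSet k m D) (j : Fin (k + 1)) :
    dist (v j) (bary v) ≤ k / (k + 1) * D := by
  have h1 : (bary v).1 = ∑ i, ((k : ℝ) + 1)⁻¹ • (v i).1 := by
    rw [bary, affine_coe]
    refine Finset.sum_congr rfl fun i _ => ?_
    congr 1
    simp [stdSimplex.barycenter]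
  have h2 : (v j).1 = ∑ i : Fin (k + 1), ((k : ℝ) + 1)⁻¹ • (v j).1 := by
    rw [Finset.sum_const, Finset.card_univ, Fintype.card_fin, ← Nat.cast_smul_eq_nsmul ℝ, smul_smul]
    push_cast
    rw [mul_inv_cancel₀ (by positivity), one_smul]
  rw [Subtype.dist_eq, dist_eq_norm, h1]
  nth_rewrite 1 [h2]
  rw [← Finset.sum_sub_distrib]
  calc _ ≤ ∑ i, ‖((k : ℝ) + 1)⁻¹ • (v j).1 - ((k : ℝ) + 1)⁻¹ • (v i).1‖ := norm_sum_le _ _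
    _ = ∑ i, ((k : ℝ) + 1)⁻¹ * dist (v j) (v i) := by
        refine Finset.sum_congr rfl fun i _ => ?_
        rw [← smul_sub, norm_smul, Subtype.dist_eq, dist_eq_norm,
        Real.norm_of_nonneg (by positivity)]
    _ = ∑ i ∈ Finset.univ.erase j, ((k : ℝ) + 1)⁻¹ * dist (v j) (v i) := by
        rw [Finset.sum_erase]; simp
    _ ≤ ∑ i ∈ Finset.univ.erase j, ((k : ℝ) + 1)⁻¹ * D := by
        refine Finset.sum_le_sum fun i _ => ?_
        exact mul_le_mul_of_nonneg_left (hv j i) (by positivity)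
    _ = k / (k + 1) * D := by
        rw [Finset.sum_const, Finset.card_erase_of_mem (Finset.mem_univ _)]
        simp
        ring

lemma sd_mem_diam {k m : ℕ} (v : Fin (k + 1) → Simp m) {D : ℝ} (hv : v ∈ diamSet k m D) :
    sd m k (Finsupp.single v 1) ∈ Finsupp.supported ℤ ℤ (diamSet k m (k / (k + 1) * D)) := by
  have hD : 0 ≤ D := dist_nonneg.trans (hv 0 0)
  induction k with
  | zero =>
    refine single_mem_supported (fun i j => ?_) 1
    rw [Subsingleton.elim (α := Fin 1) i j]
    simp
  | succ k ih =>
    rw [sd_single, abd_single, map_sum, map_sum]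
    refine Submodule.sum_mem _ fun i _ => ?_
    rw [map_smul, map_smul]
    refine Submodule.smul_mem _ _ ?_
    have h1 := ih (v ∘ i.succAbove) (fun a b => hv _ _)
    have h2 := sd_mem_hull (v ∘ i.succAbove)
    have h3 := Finsupp.supported_inter (M := ℤ) (R := ℤ) (diamSet k m (k / (k + 1) * D))
      (hullSet (l := k) (v ∘ i.succAbove)) ▸ Submodule.mem_inf.2 ⟨h1, h2⟩
    refine map_mem_of_mem_supported _ _ (fun w hw => ?_) h3
    rw [cone_single]
    have hb : ∀ a, dist (w a) (bary v) ≤ ((k + 1 : ℕ) : ℝ) / ((k + 1 : ℕ) + 1) * D :=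
      hw.2 _ _ fun a => dist_bary_le v hv _
    have hle : (k : ℝ) / (k + 1) * D ≤ ((k + 1 : ℕ) : ℝ) / ((k + 1 : ℕ) + 1) * D := by
      refine mul_le_mul_of_nonneg_right ?_ hD
      rw [div_le_div_iff₀ (by positivity) (by positivity)]
      push_cast
      nlinarith
    refine single_mem_supported (fun a b => ?_) 1
    refine Fin.cases ?_ (fun a => ?_) a <;> refine Fin.cases ?_ (fun b => ?_) b
    · simp only [dist_self]; positivity
    · simpa [dist_comm] using hb b
    · simpa using hb a
    · simpa using (hw.1 a b).trans hle

lemma sd_iterate_mem_diam {k m : ℕ} (v : Fin (k + 1) → Simp m) {D : ℝ} (hv : v ∈ diamSet k m D)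
    (K : ℕ) : (sd m k ^ K) (Finsupp.single v 1) ∈
      Finsupp.supported ℤ ℤ (diamSet k m ((k / (k + 1)) ^ K * D)) := by
  induction K with
  | zero => exact single_mem_supported (by simpa using hv) 1
  | succ K ih =>
    rw [pow_succ' (sd m k), Module.End.mul_apply]
    refine map_mem_of_mem_supported _ _ (fun w hw => ?_) ih
    rw [pow_succ', mul_assoc]
    exact sd_mem_diam w hw

/-- Chains all of whose simplices lie in `U` or in `V`. -/
def smallChains (U V : Set X) (n : ℕ) : Submodule ℤ (Chain n X) :=
  Finsupp.supported ℤ ℤ {σ | (∀ t, σ t ∈ U) ∨ ∀ t, σ t ∈ V}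

variable {U V : Set X}

lemma push_mem_small {k m : ℕ} {σ : C(Simp m, X)} (h : (∀ t, σ t ∈ U) ∨ ∀ t, σ t ∈ V)
    (c : AffChain k m) : push σ k c ∈ smallChains U V k := by
  refine map_mem_of_mem_supported (s := Set.univ) _ _ (fun v _ => ?_) (by simp)
  rw [push_single]
  refine single_mem_supported ?_ 1
  rcases h with h | h
  · exact Or.inl fun t => h _
  · exact Or.inr fun t => h _

lemma subTX_mem_small {k : ℕ} {c : Chain k X} (hc : c ∈ smallChains U V k) :
    subTX k c ∈ smallChains U V (k + 1) := by
  refine map_mem_of_mem_supported _ _ (fun σ h => ?_) hc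
  rw [← push_vert σ, subTX_push]
  exact push_mem_small h _

lemma bdS_mem_small {k : ℕ} {c : Chain (k + 1) X} (hc : c ∈ smallChains U V (k + 1)) :
    bdS k c ∈ smallChains U V k := by
  refine map_mem_of_mem_supported _ _ (fun σ h => ?_) hc
  rw [← push_vert σ, bdS_push]
  exact push_mem_small h _

lemma sdX_pow_push {k m : ℕ} (σ : C(Simp m, X)) (c : AffChain k m) (K : ℕ) :
    (sdX k ^ K) (push σ k c) = push σ k ((sd m k ^ K) c) := by
  induction K generalizing c with
  | zero => rfl
  | succ K ih => rw [pow_succ, pow_succ, Module.End.mul_apply, sdX_push, ih, Module.End.mul_apply]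

lemma eventually_sdX_pow_single_mem (hU : IsOpen U) (hV : IsOpen V) (hUV : U ∪ V = Set.univ)
    {k : ℕ} (σ : C(Simp k, X)) :
    ∀ᶠ K in Filter.atTop, (sdX k ^ K) (Finsupp.single σ 1) ∈ smallChains U V k := by
  obtain ⟨δ, hδ, hcov⟩ := lebesgue_number_lemma_of_metric (isCompact_univ (X := Simp k))
    (c := fun b : Bool => σ ⁻¹' (if b then U else V))
    (by
      rintro (_ | _)
      · exact hV.preimage σ.continuous
      · exact hU.preimage σ.continuous)
    (by
      intro t _
      rcases (hUV ▸ Set.mem_univ (σ t) : σ t ∈ U ∪ V) with h | h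
      · exact Set.mem_iUnion.2 ⟨true, by simpa using h⟩
      · exact Set.mem_iUnion.2 ⟨false, by simpa using h⟩)
  obtain ⟨D, hD⟩ := Metric.isBounded_iff.1 (isCompact_univ (X := Simp k)).isBounded
  have hv : (vert : Fin (k + 1) → Simp k) ∈ diamSet k k D :=
    fun i j => hD (Set.mem_univ _) (Set.mem_univ _)
  have hlim : Filter.Tendsto (fun K : ℕ => ((k : ℝ) / (k + 1)) ^ K * D) Filter.atTop
      (nhds (0 * D)) := by
    refine (tendsto_pow_atTop_nhds_zero_of_lt_one (by positivity) ?_).mul_const D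
    rw [div_lt_one (by positivity)]
    linarith
  rw [zero_mul] at hlim
  filter_upwards [hlim.eventually (gt_mem_nhds hδ)] with K hK
  rw [← push_vert σ, sdX_pow_push]
  refine map_mem_of_mem_supported _ _ (fun w hw => ?_) (sd_iterate_mem_diam vert hv K)
  rw [push_single]
  refine single_mem_supported ?_ 1
  obtain ⟨b, hb⟩ := hcov (w 0) (Set.mem_univ _)
  have key : ∀ t, σ (affine w t) ∈ (if b then U else V) := fun t =>
    hb (Metric.mem_ball.2 ((dist_affine_le w t (w 0) _ fun i => hw i 0).trans_lt hK))
  cases b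
  · exact Or.inr key
  · exact Or.inl key

lemma exists_sdX_pow_mem (hU : IsOpen U) (hV : IsOpen V) (hUV : U ∪ V = Set.univ)
    {k : ℕ} (c : Chain k X) : ∃ K, (sdX k ^ K) c ∈ smallChains U V k := by
  suffices h : ∀ᶠ K in Filter.atTop, (sdX k ^ K) c ∈ smallChains U V k from h.exists
  induction c using Finsupp.induction_linear with
  | zero => simp
  | add f g hf hg =>
    filter_upwards [hf, hg] with K h1 h2
    rw [map_add]
    exact add_mem h1 h2
  | single σ a =>
    filter_upwards [eventually_sdX_pow_single_mem hU hV hUV σ] with K h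
    rw [← mul_one a, ← smul_eq_mul, ← Finsupp.smul_single, map_smul]
    exact Submodule.smul_mem _ _ h

lemma mem_small_zero (hUV : U ∪ V = Set.univ) (c : Chain 0 X) : c ∈ smallChains U V 0 := by
  have : {σ : C(Simp 0, X) | (∀ t, σ t ∈ U) ∨ ∀ t, σ t ∈ V} = Set.univ := by
    refine Set.eq_univ_of_forall fun σ => ?_
    rcases (hUV ▸ Set.mem_univ (σ (vert 0)) : σ (vert 0) ∈ U ∪ V) with h | h
    · exact Or.inl fun t => Subsingleton.elim (vert 0) t ▸ h
    · exact Or.inr fun t => Subsingleton.elim (vert 0) t ▸ h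
  rw [smallChains, this]
  simp

/-- A chain with small boundary is small up to a boundary. -/
lemma exists_sub_bdS_mem_small (hU : IsOpen U) (hV : IsOpen V) (hUV : U ∪ V = Set.univ)
    {k : ℕ} (c : Chain (k + 1) X) (hc : bdS k c ∈ smallChains U V k) :
    ∃ e, c - bdS (k + 1) e ∈ smallChains U V (k + 1) := by
  obtain ⟨K, hK⟩ := exists_sdX_pow_mem hU hV hUV c
  induction K generalizing c with
  | zero => exact ⟨0, by simpa using hK⟩
  | succ K ih =>
    have hT := subTX_mem_small hc
    have key := bdS_subTX c
    have hsd : sdX (k + 1) c = c - subTX k (bdS k c) - bdS (k + 1) (subTX (k + 1) c) := by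
      rw [key]; abel
    obtain ⟨e, he⟩ := ih (sdX (k + 1) c) (by
      rw [hsd, map_sub, map_sub, bdS_bdS, sub_zero]
      exact sub_mem hc (bdS_mem_small hT)) (by
      rwa [pow_succ, Module.End.mul_apply] at hK)
    refine ⟨e + subTX (k + 1) c, ?_⟩
    have : c - bdS (k + 1) (e + subTX (k + 1) c) =
        (sdX (k + 1) c - bdS (k + 1) e) + subTX k (bdS k c) := by
      rw [map_add, hsd]; abel
    rw [this]
    exact add_mem he hT

end SmallChains

section Homology

variable {X Y Z : Type} [TopologicalSpace X] [TopologicalSpace Y] [TopologicalSpace Z]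

/-- The boundary of singular chains in all degrees. -/
noncomputable def bd : (n : ℕ) → (Chain n X →ₗ[ℤ] Chain (n - 1) X)
  | 0 => 0
  | n + 1 => bdS n

lemma bd_bdS (n : ℕ) (c : Chain (n + 1) X) : bd n (bdS n c) = 0 := by
  cases n with
  | zero => rfl
  | succ n => exact bdS_bdS n c

lemma pushf_bd (f : C(X, Y)) (n : ℕ) (c : Chain n X) :
    pushf f (n - 1) (bd n c) = bd n (pushf f n c) := by
  cases n with
  | zero => simp [bd]
  | succ n => exact pushf_bdS f n c

lemma pushf_comp (g : C(Y, Z)) (f : C(X, Y)) (n : ℕ) (c : Chain n X) :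
    pushf (g.comp f) n c = pushf g n (pushf f n c) := by
  suffices h : pushf (g.comp f) n = pushf g n ∘ₗ pushf f n from LinearMap.congr_fun h c
  ext σ : 2
  simp [ContinuousMap.comp_assoc]

lemma pushf_id (n : ℕ) (c : Chain n X) : pushf (ContinuousMap.id X) n c = c := by
  suffices h : pushf (ContinuousMap.id X) n = LinearMap.id from LinearMap.congr_fun h c
  ext σ : 2
  simp

/-- Singular cycles. -/
noncomputable abbrev Cyc (n : ℕ) (X : Type) [TopologicalSpace X] : Submodule ℤ (Chain n X) :=
  LinearMap.ker (bd n)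

/-- Singular homology as a quotient of cycles. -/
abbrev Hom (n : ℕ) (X : Type) [TopologicalSpace X] : Type :=
  Cyc n X ⧸ (LinearMap.range (bdS n)).comap (Cyc n X).subtype

/-- The homology class of a cycle. -/
noncomputable def cls {n : ℕ} (c : Chain n X) (hc : bd n c = 0) : Hom n X :=
  Submodule.Quotient.mk ⟨c, hc⟩

lemma exists_cls {n : ℕ} (x : Hom n X) : ∃ c hc, x = cls c hc := by
  obtain ⟨⟨c, hc⟩, rfl⟩ := Submodule.Quotient.mk_surjective _ x
  exact ⟨c, hc, rfl⟩

lemma cls_eq_zero_iff {n : ℕ} {c : Chain n X} {hc : bd n c = 0} :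
    cls c hc = 0 ↔ ∃ e, bdS n e = c :=
  (Submodule.Quotient.mk_eq_zero _).trans Iff.rfl

lemma cls_add {n : ℕ} {c c' : Chain n X} (hc : bd n c = 0) (hc' : bd n c' = 0) :
    cls c hc + cls c' hc' = cls (c + c') (by rw [map_add, hc, hc', add_zero]) := rfl

lemma cls_sub {n : ℕ} {c c' : Chain n X} (hc : bd n c = 0) (hc' : bd n c' = 0) :
    cls c hc - cls c' hc' = cls (c - c') (by rw [map_sub, hc, hc', sub_zero]) := rfl

lemma cls_neg {n : ℕ} {c : Chain n X} (hc : bd n c = 0) :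
    -cls c hc = cls (-c) (by rw [map_neg, hc, neg_zero]) := rfl

lemma cls_smul {n : ℕ} {c : Chain n X} (a : ℤ) (hc : bd n c = 0) :
    a • cls c hc = cls (a • c) (by rw [map_smul, hc, smul_zero]) := rfl

lemma cls_eq_iff {n : ℕ} {c c' : Chain n X} {hc : bd n c = 0} {hc' : bd n c' = 0} :
    cls c hc = cls c' hc' ↔ ∃ e, bdS n e = c - c' := by
  rw [← sub_eq_zero, cls_sub, cls_eq_zero_iff]

/-- The map induced on homology. -/
noncomputable def Hmap (f : C(X, Y)) (n : ℕ) : Hom n X →ₗ[ℤ] Hom n Y :=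
  Submodule.mapQ _ _ ((pushf f n).restrict fun c hc => by
      change bd n c = 0 at hc
      change bd n (pushf f n c) = 0
      rw [← pushf_bd, hc, map_zero]) (by
    rintro ⟨c, hc⟩ ⟨e, he⟩
    exact ⟨pushf f (n + 1) e, by rw [← pushf_bdS, he]; rfl⟩)

lemma pushf_cyc (f : C(X, Y)) {n : ℕ} {c : Chain n X} (hc : bd n c = 0) :
    bd n (pushf f n c) = 0 := by
  rw [← pushf_bd, hc, map_zero]

lemma Hmap_cls (f : C(X, Y)) {n : ℕ} {c : Chain n X} (hc : bd n c = 0) :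
    Hmap f n (cls c hc) = cls (pushf f n c) (pushf_cyc f hc) := rfl

lemma Hmap_comp (g : C(Y, Z)) (f : C(X, Y)) (n : ℕ) (x : Hom n X) :
    Hmap (g.comp f) n x = Hmap g n (Hmap f n x) := by
  obtain ⟨c, hc, rfl⟩ := exists_cls x
  simp only [Hmap_cls, pushf_comp]

lemma Hmap_id (n : ℕ) (x : Hom n X) : Hmap (ContinuousMap.id X) n x = x := by
  obtain ⟨c, hc, rfl⟩ := exists_cls x
  simp only [Hmap_cls, pushf_id]

/-- Homotopic maps induce the same map on homology. -/
lemma Hmap_eq_of_homotopic {f g : C(X, Y)} (h : f.Homotopic g) (n : ℕ) : Hmap f n = Hmap g n := by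
  obtain ⟨F⟩ := h
  have F' : TopCat.Homotopy (TopCat.ofHom f) (TopCat.ofHom g) := F
  have K : Homotopy (complexFunctor.map (TopCat.ofHom f)) (complexFunctor.map (TopCat.ofHom g)) :=
    (F'.toSSet.toSimplicialObjectHomotopy.whiskerRight (ModuleCat.free ℤ)).toChainHomotopy
  ext1
  ext1 ⟨c, hc⟩
  change cls _ (pushf_cyc f hc) = cls _ (pushf_cyc g hc)
  rw [cls_eq_iff]
  obtain ⟨x, rfl⟩ := (chainEquiv n X).surjective c
  refine ⟨chainEquiv (n + 1) Y ((K.hom n (n + 1)).hom x), ?_⟩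
  rw [← chainEquiv_d, ← chainEquiv_map, ← chainEquiv_map, ← map_sub]
  congr 1
  have hcomm := K.comm n
  have hd : dNext n K.hom x = 0 := by
    cases n with
    | zero => rw [Homotopy.dNext_zero_chainComplex]; rfl
    | succ n =>
      rw [Homotopy.dNext_succ_chainComplex, ModuleCat.comp_apply]
      have : (cpx X).d (n + 1) n x = 0 := by
        apply (chainEquiv n X).injective
        rw [chainEquiv_d, map_zero]
        exact hc
      erw [this]
      exact map_zero _
  rw [hcomm, Homotopy.prevD_chainComplex]
  change _ = (dNext n K.hom x + _ + _) - _
  rw [hd, zero_add, add_sub_cancel_right]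
  rfl

/-- A homotopy equivalence induces isomorphisms on homology. -/
lemma Hmap_bijective_of_inverse (f : C(X, Y)) (g : C(Y, X))
    (hgf : (g.comp f).Homotopic (ContinuousMap.id X))
    (hfg : (f.comp g).Homotopic (ContinuousMap.id Y)) (n : ℕ) :
    Function.Bijective (Hmap f n) := by
  refine ⟨Function.LeftInverse.injective (g := Hmap g n) fun x => ?_,
    Function.RightInverse.surjective (g := Hmap g n) fun y => ?_⟩
  · rw [← Hmap_comp, Hmap_eq_of_homotopic hgf, Hmap_id]
  · rw [← Hmap_comp, Hmap_eq_of_homotopic hfg, Hmap_id]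

lemma Hmap_bijective (e : ContinuousMap.HomotopyEquiv X Y) (n : ℕ) :
    Function.Bijective (Hmap e.toFun n) :=
  Hmap_bijective_of_inverse e.toFun e.invFun e.left_inv e.right_inv n

lemma Hmap_homeomorph_bijective (e : X ≃ₜ Y) (n : ℕ) :
    Function.Bijective (Hmap (e : C(X, Y)) n) :=
  Hmap_bijective e.toHomotopyEquiv n

/-- A homeomorphism induces a linear equivalence on homology. -/
noncomputable def homCongr (e : X ≃ₜ Y) (n : ℕ) : Hom n X ≃ₗ[ℤ] Hom n Y :=
  LinearEquiv.ofBijective _ (Hmap_homeomorph_bijective e n)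

/-- Comparison of the two models of singular homology. -/
noncomputable def shEquiv (n : ℕ) (X : Type) [TopologicalSpace X] : SH n X ≃ₗ[ℤ] Hom n X := by
  have e1 : (SH n X : ModuleCat ℤ) ≅ ((cpx X).sc' (n + 1) n (n - 1)).homology :=
    ShortComplex.homologyMapIso ((cpx X).isoSc' (n + 1) n (n - 1) (ChainComplex.prev ℕ n) (by
      cases n <;> simp))
  refine (e1 ≪≫ ShortComplex.moduleCatHomologyIso _).toLinearEquiv ≪≫ₗ ?_
  have hd : ∀ x : (cpx X).X n, (cpx X).d n (n - 1) x = 0 ↔ bd n (chainEquiv n X x) = 0 := by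
    intro x
    cases n with
    | zero =>
      have : (cpx X).d 0 (0 - 1) = 0 := (cpx X).shape _ _ (by simp)
      rw [this]
      simp [bd]
    | succ n =>
      have := chainEquiv_d n x
      change _ ↔ bdS n _ = 0
      rw [← this, map_eq_zero_iff _ (chainEquiv n X).injective]
      rfl
  refine Submodule.Quotient.equiv _ _ ((chainEquiv n X).ofSubmodules _ (Cyc n X) ?_) ?_
  · ext c
    constructor
    · rintro ⟨x, hx, rfl⟩
      exact (hd x).1 hx
    · intro hc
      exact ⟨(chainEquiv n X).symm c, (hd _).2 (by simpa using hc), by simp⟩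
  · ext ⟨c, hc⟩
    constructor
    · rintro ⟨_, ⟨y, rfl⟩, hy⟩
      refine ⟨chainEquiv (n + 1) X y, ?_⟩
      exact (chainEquiv_d n y).symm.trans (congrArg Subtype.val hy)
    · rintro ⟨e, he⟩
      refine ⟨_, ⟨(chainEquiv (n + 1) X).symm e, rfl⟩, ?_⟩
      apply Subtype.ext
      refine (chainEquiv_d n _).trans ?_
      rw [LinearEquiv.apply_symm_apply]
      exact he

end Homology

section MayerVietoris

variable {X Y Z W A B : Type} [TopologicalSpace X] [TopologicalSpace Y] [TopologicalSpace Z]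
  [TopologicalSpace W] [TopologicalSpace A] [TopologicalSpace B]

lemma pushf_injective {i : C(X, Y)} (hi : Function.Injective i) (n : ℕ) :
    Function.Injective (pushf i n) := by
  refine Finsupp.mapDomain_injective fun σ τ h => ?_
  ext1 t
  exact hi (DFunLike.congr_fun h t)

lemma pushf_mem_supported (i : C(X, Y)) {n : ℕ} (c : Chain n X) :
    pushf i n c ∈ Finsupp.supported ℤ ℤ {σ : C(Simp n, Y) | ∀ t, σ t ∈ Set.range i} := by
  refine map_mem_of_mem_supported (s := Set.univ) _ _ (fun σ _ => ?_) (by simp)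
  rw [pushf_single]
  exact single_mem_supported (fun t => ⟨σ t, rfl⟩) 1

lemma exists_lift {i : C(X, Y)} (hi : Topology.IsEmbedding i) {n : ℕ} (σ : C(Simp n, Y))
    (h : ∀ t, σ t ∈ Set.range i) : ∃ τ : C(Simp n, X), i.comp τ = σ := by
  choose g hg using h
  refine ⟨⟨g, hi.continuous_iff.2 ?_⟩, ?_⟩
  · have : i ∘ g = σ := funext hg
    rw [this]
    exact σ.continuous
  · ext1 t
    exact hg t

lemma exists_pushf_eq {i : C(X, Y)} (hi : Topology.IsEmbedding i) {n : ℕ} {c : Chain n Y}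
    (hc : c ∈ Finsupp.supported ℤ ℤ {σ : C(Simp n, Y) | ∀ t, σ t ∈ Set.range i}) :
    ∃ c', pushf i n c' = c := by
  refine LinearMap.mem_range.1 ?_
  refine map_mem_of_mem_supported (LinearMap.range (pushf i n)) LinearMap.id (fun σ h => ?_) hc
  obtain ⟨τ, rfl⟩ := exists_lift hi σ h
  exact ⟨Finsupp.single τ 1, pushf_single _ _ _ _⟩

lemma pushf_mem_small_left (iA : C(A, X)) (iB : C(B, X)) {n : ℕ} (p : Chain n A) :
    pushf iA n p ∈ smallChains (Set.range iA) (Set.range iB) n :=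
  Finsupp.supported_mono (fun _ h => Or.inl h) (pushf_mem_supported iA p)

lemma pushf_mem_small_right (iA : C(A, X)) (iB : C(B, X)) {n : ℕ} (q : Chain n B) :
    pushf iB n q ∈ smallChains (Set.range iA) (Set.range iB) n :=
  Finsupp.supported_mono (fun _ h => Or.inr h) (pushf_mem_supported iB q)

/-- A space covered by two open subspaces, together with their intersection. -/
structure IsMVSquare (jA : C(W, A)) (jB : C(W, B)) (iA : C(A, X)) (iB : C(B, X)) : Prop where
  comm : ∀ w, iA (jA w) = iB (jB w)
  openA : Topology.IsOpenEmbedding iA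
  openB : Topology.IsOpenEmbedding iB
  cover : ∀ x, x ∈ Set.range iA ∨ x ∈ Set.range iB
  embedding : Topology.IsEmbedding jA
  exists_of_eq : ∀ a b, iA a = iB b → ∃ w, jA w = a ∧ jB w = b

namespace IsMVSquare

variable {jA : C(W, A)} {jB : C(W, B)} {iA : C(A, X)} {iB : C(B, X)}

lemma comp_eq (S : IsMVSquare jA jB iA iB) : iA.comp jA = iB.comp jB := by
  ext1 w
  exact S.comm w

lemma pushf_comm (S : IsMVSquare jA jB iA iB) {n : ℕ} (c : Chain n W) :
    pushf iA n (pushf jA n c) = pushf iB n (pushf jB n c) := by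
  rw [← pushf_comp, ← pushf_comp, S.comp_eq]

lemma Hmap_comm (S : IsMVSquare jA jB iA iB) {n : ℕ} (x : Hom n W) :
    Hmap iA n (Hmap jA n x) = Hmap iB n (Hmap jB n x) := by
  rw [← Hmap_comp, ← Hmap_comp, S.comp_eq]

lemma exists_chain_of_pushf_add_eq_zero (S : IsMVSquare jA jB iA iB)
    {n : ℕ} {p : Chain n A} {q : Chain n B}
    (h : pushf iA n p + pushf iB n q = 0) :
    ∃ c : Chain n W, pushf jA n c = p ∧ pushf jB n c = -q := by
  have hpq : pushf iA n p = pushf iB n (-q) := by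
    rw [map_neg]
    exact eq_neg_of_add_eq_zero_left h
  have h1 := pushf_mem_supported iA p
  have h2 := pushf_mem_supported iB (-q)
  rw [← hpq] at h2
  have h3 := (Finsupp.supported_inter (M := ℤ) (R := ℤ) {σ : C(Simp n, X) | ∀ t, σ t ∈ Set.range iA}
      {σ : C(Simp n, X) | ∀ t, σ t ∈ Set.range iB}) ▸ Submodule.mem_inf.2 ⟨h1, h2⟩
  have hk : Topology.IsEmbedding (iA.comp jA) := S.openA.isEmbedding.comp S.embedding
  have h4 : {σ : C(Simp n, X) | ∀ t, σ t ∈ Set.range iA} ∩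
      {σ : C(Simp n, X) | ∀ t, σ t ∈ Set.range iB} ⊆
      {σ : C(Simp n, X) | ∀ t, σ t ∈ Set.range (iA.comp jA)} := by
    rintro σ ⟨ha, hb⟩ t
    obtain ⟨a, ha⟩ := ha t
    obtain ⟨b, hb⟩ := hb t
    obtain ⟨w, rfl, rfl⟩ := S.exists_of_eq a b (ha.trans hb.symm)
    exact ⟨w, ha⟩
  obtain ⟨c, hc⟩ := exists_pushf_eq hk (Finsupp.supported_mono h4 h3)
  rw [pushf_comp] at hc
  refine ⟨c, pushf_injective S.openA.injective n hc, pushf_injective S.openB.injective n ?_⟩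
  rw [← S.pushf_comm, hc, hpq]

lemma small_pushf (S : IsMVSquare jA jB iA iB) {n : ℕ} {c : Chain n X}
    (hc : c ∈ smallChains (Set.range iA) (Set.range iB) n) :
    ∃ p q, c = pushf iA n p + pushf iB n q := by
  have h1 : c ∈ LinearMap.range (pushf iA n) ⊔ LinearMap.range (pushf iB n) := by
    refine map_mem_of_mem_supported _ LinearMap.id (fun σ h => ?_) hc
    rcases h with h | h
    · obtain ⟨τ, rfl⟩ := exists_lift S.openA.isEmbedding σ h
      exact Submodule.mem_sup_left ⟨Finsupp.single τ 1, pushf_single _ _ _ _⟩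
    · obtain ⟨τ, rfl⟩ := exists_lift S.openB.isEmbedding σ h
      exact Submodule.mem_sup_right ⟨Finsupp.single τ 1, pushf_single _ _ _ _⟩
  obtain ⟨_, ⟨p, rfl⟩, _, ⟨q, rfl⟩, h⟩ := Submodule.mem_sup.1 h1
  exact ⟨p, q, h.symm⟩

lemma union_eq (S : IsMVSquare jA jB iA iB) : Set.range iA ∪ Set.range iB = Set.univ :=
  Set.eq_univ_of_forall S.cover

/-- A chain whose boundary is a sum of chains in the two pieces is such a sum up to a boundary. -/
lemma exists_eq_add_bdS (S : IsMVSquare jA jB iA iB) {n : ℕ} (c : Chain n X)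
    (hc : bd n c ∈ smallChains (Set.range iA) (Set.range iB) (n - 1)) :
    ∃ p q e, c = pushf iA n p + pushf iB n q + bdS n e := by
  cases n with
  | zero =>
    obtain ⟨p, q, h⟩ := S.small_pushf (mem_small_zero S.union_eq c)
    exact ⟨p, q, 0, by rw [h, map_zero, add_zero]⟩
  | succ n =>
    obtain ⟨e, he⟩ := exists_sub_bdS_mem_small S.openA.isOpen_range S.openB.isOpen_range S.union_eq
      c hc
    obtain ⟨p, q, h⟩ := S.small_pushf he
    exact ⟨p, q, e, by rw [← h, sub_add_cancel]⟩

lemma exact_middle (S : IsMVSquare jA jB iA iB) {n : ℕ} (a : Hom n A) (b : Hom n B)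
    (h : Hmap iA n a + Hmap iB n b = 0) :
    ∃ w, Hmap jA n w = a ∧ Hmap jB n w = -b := by
  obtain ⟨p, hp, rfl⟩ := exists_cls a
  obtain ⟨q, hq, rfl⟩ := exists_cls b
  rw [Hmap_cls, Hmap_cls, cls_add, cls_eq_zero_iff] at h
  obtain ⟨e, he⟩ := h
  obtain ⟨p', q', f, rfl⟩ := S.exists_eq_add_bdS e (by
    change bdS n e ∈ _
    rw [he]
    exact add_mem (pushf_mem_small_left iA iB _) (pushf_mem_small_right iA iB _))
  rw [map_add, map_add, bdS_bdS, add_zero, ← pushf_bdS, ← pushf_bdS] at he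
  obtain ⟨c, hcA, hcB⟩ := S.exists_chain_of_pushf_add_eq_zero
    (p := p - bdS n p') (q := q - bdS n q') (by
      rw [map_sub, map_sub, sub_add_sub_comm, he, sub_self])
  have hc : bd n c = 0 := by
    apply pushf_injective S.embedding.injective
    rw [pushf_bd, hcA, map_sub, hp, bd_bdS, sub_zero, map_zero]
  refine ⟨cls c hc, ?_, ?_⟩
  · rw [Hmap_cls, cls_eq_iff]
    exact ⟨-p', by rw [map_neg, hcA]; abel⟩
  · rw [Hmap_cls, cls_neg, cls_eq_iff]
    exact ⟨q', by rw [hcB]; abel⟩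

/-- The graph of the connecting homomorphism. -/
def conn (_ : IsMVSquare jA jB iA iB) (n : ℕ) : Submodule ℤ (Hom (n + 1) X × Hom n W) where
  carrier := {z | ∃ (p : Chain (n + 1) A) (q : Chain (n + 1) B) (c : Chain n W)
    (hc : bd n c = 0) (hpq : bd (n + 1) (pushf iA (n + 1) p + pushf iB (n + 1) q) = 0),
    z = (cls _ hpq, cls c hc) ∧ pushf jA n c = bdS n p ∧ pushf jB n c = -bdS n q}
  zero_mem' := ⟨0, 0, 0, map_zero _, by simp only [map_zero, add_zero], by
    refine ⟨?_, by simp, by simp⟩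
    ext1 <;> symm <;> refine cls_eq_zero_iff.2 ⟨0, ?_⟩ <;> simp⟩
  add_mem' := by
    rintro _ _ ⟨p, q, c, hc, hpq, rfl, h1, h2⟩ ⟨p', q', c', hc', hpq', rfl, h1', h2'⟩
    refine ⟨p + p', q + q', c + c', by rw [map_add, hc, hc', add_zero], ?_, ?_, ?_, ?_⟩
    · have := congrArg₂ (· + ·) hpq hpq'
      simp only [← map_add, add_zero] at this
      rw [← this]
      congr 1
      simp only [map_add]
      abel
    · ext1
      · dsimp only [Prod.fst_add]
        rw [cls_add, cls_eq_iff]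
        refine ⟨0, ?_⟩
        simp only [map_add, map_zero]
        abel
      · rfl
    · rw [map_add, map_add, h1, h1']
    · rw [map_add, map_add, h2, h2']; abel
  smul_mem' := by
    rintro a _ ⟨p, q, c, hc, hpq, rfl, h1, h2⟩
    refine ⟨a • p, a • q, a • c, by rw [map_smul, hc, smul_zero], ?_, ?_, ?_, ?_⟩
    · have := congrArg (a • ·) hpq
      simp only [smul_zero] at this
      rw [← this]
      simp only [map_add, map_smul, smul_add]
    · ext1
      · dsimp only [Prod.smul_fst]
        rw [cls_smul, cls_eq_iff]
        refine ⟨0, ?_⟩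
        simp only [map_smul, map_zero, smul_add]
        abel
      · rfl
    · rw [map_smul, map_smul, h1]
    · rw [map_smul, map_smul, h2, smul_neg]

lemma conn_mem_ker (S : IsMVSquare jA jB iA iB) {n : ℕ} {x w} (h : (x, w) ∈ S.conn n) :
    Hmap jA n w = 0 ∧ Hmap jB n w = 0 := by
  obtain ⟨p, q, c, hc, hpq, hz, h1, h2⟩ := h
  obtain ⟨rfl, rfl⟩ := Prod.ext_iff.1 hz
  exact ⟨(Hmap_cls _ _).trans (cls_eq_zero_iff.2 ⟨p, h1.symm⟩),
    (Hmap_cls _ _).trans (cls_eq_zero_iff.2 ⟨-q, by rw [map_neg, h2]⟩)⟩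

lemma exists_eq_of_conn_zero (S : IsMVSquare jA jB iA iB) {n : ℕ} {x} (h : (x, 0) ∈ S.conn n) :
    ∃ a b, x = Hmap iA (n + 1) a + Hmap iB (n + 1) b := by
  obtain ⟨p, q, c, hc, hpq, hz, h1, h2⟩ := h
  obtain ⟨rfl, h0⟩ := Prod.ext_iff.1 hz
  obtain ⟨r, rfl⟩ := cls_eq_zero_iff.1 h0.symm
  have hp : bd (n + 1) (p - pushf jA (n + 1) r) = 0 := by
    rw [map_sub, ← pushf_bd]
    exact sub_eq_zero.2 h1.symm
  have hq : bd (n + 1) (q + pushf jB (n + 1) r) = 0 := by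
    rw [map_add, ← pushf_bd]
    change bdS n q + pushf jB n (bdS n r) = 0
    rw [h2, add_neg_cancel]
  refine ⟨cls _ hp, cls _ hq, ?_⟩
  rw [Hmap_cls, Hmap_cls, cls_add, cls_eq_iff]
  refine ⟨0, ?_⟩
  simp only [map_add, map_sub, map_zero, S.pushf_comm]
  abel

lemma conn_functional (S : IsMVSquare jA jB iA iB) {n : ℕ} {w} (h : (0, w) ∈ S.conn n) : w = 0 := by
  obtain ⟨p, q, c, hc, hpq, hz, h1, h2⟩ := h
  obtain ⟨h0, rfl⟩ := Prod.ext_iff.1 hz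
  obtain ⟨e, he⟩ := cls_eq_zero_iff.1 h0.symm
  obtain ⟨p', q', f, rfl⟩ := S.exists_eq_add_bdS e (by
    change bdS (n + 1) e ∈ _
    rw [he]
    exact add_mem (pushf_mem_small_left iA iB _) (pushf_mem_small_right iA iB _))
  rw [map_add, map_add, bdS_bdS, add_zero, ← pushf_bdS, ← pushf_bdS] at he
  obtain ⟨s, hsA, hsB⟩ := S.exists_chain_of_pushf_add_eq_zero
    (p := p - bdS (n + 1) p') (q := q - bdS (n + 1) q') (by
      rw [map_sub, map_sub, sub_add_sub_comm, he, sub_self])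
  refine cls_eq_zero_iff.2 ⟨s, ?_⟩
  apply pushf_injective S.embedding.injective
  rw [pushf_bdS, hsA, map_sub, bdS_bdS, sub_zero, h1]

lemma exists_conn (S : IsMVSquare jA jB iA iB) {n : ℕ} (x : Hom (n + 1) X) :
    ∃ w, (x, w) ∈ S.conn n := by
  obtain ⟨c, hc, rfl⟩ := exists_cls x
  obtain ⟨p, q, f, rfl⟩ := S.exists_eq_add_bdS c (by rw [hc]; exact zero_mem _)
  have hpq : bd (n + 1) (pushf iA (n + 1) p + pushf iB (n + 1) q) = 0 := by
    rwa [map_add, bd_bdS, add_zero] at hc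
  have h0 : pushf iA n (bdS n p) + pushf iB n (bdS n q) = 0 := by
    rw [pushf_bdS, pushf_bdS, ← map_add]
    exact hpq
  obtain ⟨w, hwA, hwB⟩ := S.exists_chain_of_pushf_add_eq_zero h0
  have hw : bd n w = 0 := by
    apply pushf_injective S.embedding.injective
    rw [pushf_bd, hwA, bd_bdS, map_zero]
  refine ⟨cls w hw, p, q, w, hw, hpq, ?_, hwA, hwB⟩
  ext1
  · exact cls_eq_iff.2 ⟨f, by abel⟩
  · rfl

lemma exists_conn_of_ker (S : IsMVSquare jA jB iA iB) {n : ℕ} (w : Hom n W)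
    (hA : Hmap jA n w = 0) (hB : Hmap jB n w = 0) :
    ∃ x, (x, w) ∈ S.conn n := by
  obtain ⟨c, hc, rfl⟩ := exists_cls w
  rw [Hmap_cls] at hA hB
  obtain ⟨p, hp⟩ := cls_eq_zero_iff.1 hA
  obtain ⟨q, hq⟩ := cls_eq_zero_iff.1 hB
  have hpq : bd (n + 1) (pushf iA (n + 1) p + pushf iB (n + 1) (-q)) = 0 := by
    rw [map_add, ← pushf_bd, ← pushf_bd, map_neg]
    change pushf iA n (bdS n p) + pushf iB n (-bdS n q) = 0
    rw [hp, hq, map_neg, S.pushf_comm, add_neg_cancel]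
  exact ⟨cls _ hpq, p, -q, c, hc, hpq, rfl, hp.symm, by rw [map_neg, neg_neg, hq]⟩

lemma conn_image (S : IsMVSquare jA jB iA iB) {n : ℕ} (a : Hom (n + 1) A) (b : Hom (n + 1) B) :
    (Hmap iA (n + 1) a + Hmap iB (n + 1) b, 0) ∈ S.conn n := by
  obtain ⟨p, hp, rfl⟩ := exists_cls a
  obtain ⟨q, hq, rfl⟩ := exists_cls b
  refine ⟨p, q, 0, map_zero _, ?_, ?_, ?_, ?_⟩
  · rw [map_add, ← pushf_bd, ← pushf_bd, hp, hq, map_zero, map_zero, add_zero]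
  · ext1
    · rfl
    · exact (cls_eq_zero_iff.2 ⟨0, map_zero _⟩).symm
  · rw [map_zero]; exact hp.symm
  · rw [map_zero]; exact (neg_eq_zero.2 hq).symm

lemma surjective_zero (S : IsMVSquare jA jB iA iB) (x : Hom 0 X) :
    ∃ a b, x = Hmap iA 0 a + Hmap iB 0 b := by
  obtain ⟨c, hc, rfl⟩ := exists_cls x
  obtain ⟨p, q, f, rfl⟩ := S.exists_eq_add_bdS c (by rw [hc]; exact zero_mem _)
  have hp : bd 0 p = 0 := rfl
  have hq : bd 0 q = 0 := rfl
  refine ⟨cls p hp, cls q hq, ?_⟩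
  rw [Hmap_cls, Hmap_cls, cls_add, cls_eq_iff]
  exact ⟨f, by abel⟩

/-- If the intersection injects on homology into one piece, the Mayer–Vietoris sequence splits into
short exact sequences. -/
lemma surjective_of_injective (S : IsMVSquare jA jB iA iB)
    (h : ∀ n, Function.Injective (Hmap jA n)) (n : ℕ) (x : Hom n X) :
    ∃ a b, x = Hmap iA n a + Hmap iB n b := by
  cases n with
  | zero => exact S.surjective_zero x
  | succ n =>
    obtain ⟨w, hw⟩ := S.exists_conn x
    have : w = 0 := h n ((S.conn_mem_ker hw).1.trans (map_zero _).symm)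
    subst this
    exact S.exists_eq_of_conn_zero hw

end IsMVSquare

end MayerVietoris

section Products

variable {X Y W A B Q : Type} [TopologicalSpace X] [TopologicalSpace Y]
  [TopologicalSpace W] [TopologicalSpace A] [TopologicalSpace B] [TopologicalSpace Q]

instance [IsEmpty X] (n : ℕ) : Subsingleton (Hom n X) := by
  refine ⟨fun x y => ?_⟩
  obtain ⟨c, hc, rfl⟩ := exists_cls x
  obtain ⟨c', hc', rfl⟩ := exists_cls y
  have : c = c' := by
    ext σ
    exact isEmptyElim (σ (vert 0))
  subst this
  rfl

namespace IsMVSquare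

variable {jA : C(W, A)} {jB : C(W, B)} {iA : C(A, X)} {iB : C(B, X)}

/-- Homology of a disjoint union of two copies of `Q`. -/
lemma nonempty_ker_equiv_of_isEmpty (S : IsMVSquare jA jB iA iB) [IsEmpty W] (π : C(X, Q)) (n : ℕ)
    (hA : Function.Bijective (Hmap (π.comp iA) n)) (hB : Function.Bijective (Hmap (π.comp iB) n)) :
    Nonempty (LinearMap.ker (Hmap π n) ≃ₗ[ℤ] Hom n Q) := by
  let eA := LinearEquiv.ofBijective _ hA
  let eB := LinearEquiv.ofBijective _ hB
  let f : Hom n Q →ₗ[ℤ] Hom n X :=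
    Hmap iA n ∘ₗ eA.symm.toLinearMap - Hmap iB n ∘ₗ eB.symm.toLinearMap
  have hfA : ∀ q, Hmap π n (Hmap iA n (eA.symm q)) = q := fun q => by
    rw [← Hmap_comp]
    exact eA.apply_symm_apply q
  have hfB : ∀ q, Hmap π n (Hmap iB n (eB.symm q)) = q := fun q => by
    rw [← Hmap_comp]
    exact eB.apply_symm_apply q
  have hf : ∀ q, f q ∈ LinearMap.ker (Hmap π n) := fun q => by
    rw [LinearMap.mem_ker]
    simp only [f, LinearMap.sub_apply, LinearMap.comp_apply, LinearEquiv.coe_coe, map_sub, hfA, hfB,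
      sub_self]
  refine ⟨(LinearEquiv.ofBijective (f.codRestrict _ hf) ⟨?_, ?_⟩).symm⟩
  · rw [injective_iff_map_eq_zero]
    intro q hq
    have h : f q = 0 := congrArg Subtype.val hq
    have h' : Hmap iA n (eA.symm q) + Hmap iB n (-eB.symm q) = 0 := by
      rw [map_neg, ← sub_eq_add_neg]
      exact h
    obtain ⟨w, hw, -⟩ := S.exact_middle _ _ h'
    rw [Subsingleton.elim w 0, map_zero] at hw
    exact eA.symm.map_eq_zero_iff.1 hw.symm
  · rintro ⟨x, hx⟩
    have hinj : ∀ m, Function.Injective (Hmap jA m) := fun m => Function.injective_of_subsingleton _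
    obtain ⟨a, b, rfl⟩ := S.surjective_of_injective hinj n x
    refine ⟨eA a, Subtype.ext ?_⟩
    rw [LinearMap.mem_ker, map_add, ← Hmap_comp, ← Hmap_comp] at hx
    have hb : eB.symm (eA a) = -b := by
      rw [LinearEquiv.symm_apply_eq, map_neg]
      exact eq_neg_of_add_eq_zero_left hx
    change Hmap iA n (eA.symm (eA a)) - Hmap iB n (eB.symm (eA a)) = _
    rw [hb, LinearEquiv.symm_apply_apply, map_neg, sub_neg_eq_add]

lemma eq_zero_of_eq_add (S : IsMVSquare jA jB iA iB) (π : C(X, Q)) {n : ℕ}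
    (hA : Function.Bijective (Hmap (π.comp iA) n))
    (hjA : Function.Surjective (Hmap jA n)) (hjB : Function.Surjective (Hmap jB n))
    {a : Hom n A} {b : Hom n B} (h : Hmap π n (Hmap iA n a + Hmap iB n b) = 0) :
    Hmap iA n a + Hmap iB n b = 0 := by
  obtain ⟨w, rfl⟩ := hjA a
  obtain ⟨w', rfl⟩ := hjB b
  have h1 : Hmap iA n (Hmap jA n w) + Hmap iB n (Hmap jB n w') =
      Hmap iA n (Hmap jA n (w + w')) := by
    rw [← S.Hmap_comm w', map_add, map_add]
  rw [h1] at h ⊢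
  have h2 : Hmap (π.comp iA) n (Hmap jA n (w + w')) = 0 := (Hmap_comp _ _ _ _).trans h
  have h3 : Hmap jA n (w + w') = 0 := hA.1 (h2.trans (map_zero _).symm)
  rw [h3, map_zero]

lemma subsingleton_ker_zero (S : IsMVSquare jA jB iA iB) (π : C(X, Q))
    (hA : Function.Bijective (Hmap (π.comp iA) 0))
    (hjA : Function.Surjective (Hmap jA 0)) (hjB : Function.Surjective (Hmap jB 0)) :
    Subsingleton (LinearMap.ker (Hmap π 0)) := by
  refine subsingleton_of_forall_eq 0 fun ⟨x, hx⟩ => Subtype.ext ?_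
  obtain ⟨a, b, rfl⟩ := S.surjective_zero x
  exact S.eq_zero_of_eq_add π hA hjA hjB hx

/-- The suspension isomorphism. -/
lemma nonempty_ker_equiv (S : IsMVSquare jA jB iA iB) (π : C(X, Q))
    (hA : ∀ n, Function.Bijective (Hmap (π.comp iA) n))
    (hB : ∀ n, Function.Bijective (Hmap (π.comp iB) n))
    (hjA : ∀ n, Function.Surjective (Hmap jA n)) (hjB : ∀ n, Function.Surjective (Hmap jB n))
    (n : ℕ) :
    Nonempty (LinearMap.ker (Hmap π (n + 1)) ≃ₗ[ℤ]
      LinearMap.ker (Hmap ((π.comp iA).comp jA) n)) := by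
  let R : Submodule ℤ (Hom (n + 1) X × Hom n W) :=
    S.conn n ⊓ (LinearMap.ker (Hmap π (n + 1))).comap (LinearMap.fst _ _ _)
  have h1 : ∀ z : R, z.1.1 ∈ LinearMap.ker (Hmap π (n + 1)) := fun z => z.2.2
  have h2 : ∀ z : R, z.1.2 ∈ LinearMap.ker (Hmap ((π.comp iA).comp jA) n) := fun z => by
    rw [LinearMap.mem_ker, Hmap_comp, (S.conn_mem_ker z.2.1).1, map_zero]
  let f : R →ₗ[ℤ] LinearMap.ker (Hmap π (n + 1)) :=
    (LinearMap.fst ℤ _ _ ∘ₗ R.subtype).codRestrict _ h1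
  let g : R →ₗ[ℤ] LinearMap.ker (Hmap ((π.comp iA).comp jA) n) :=
    (LinearMap.snd ℤ _ _ ∘ₗ R.subtype).codRestrict _ h2
  have hf : Function.Bijective f := by
    constructor
    · rw [injective_iff_map_eq_zero]
      rintro ⟨⟨x, w⟩, hz⟩ h0
      have hx : x = 0 := congrArg Subtype.val h0
      subst hx
      have hw := S.conn_functional hz.1
      subst hw
      rfl
    · rintro ⟨x, hx⟩
      obtain ⟨w, hw⟩ := S.exists_conn x
      exact ⟨⟨(x, w), hw, hx⟩, rfl⟩
  have hg : Function.Bijective g := by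
    constructor
    · rw [injective_iff_map_eq_zero]
      rintro ⟨⟨x, w⟩, hz⟩ h0
      have hw : w = 0 := congrArg Subtype.val h0
      subst hw
      obtain ⟨a, b, rfl⟩ := S.exists_eq_of_conn_zero hz.1
      have := S.eq_zero_of_eq_add π (hA _) (hjA _) (hjB _) hz.2
      exact Subtype.ext (Prod.ext this rfl)
    · rintro ⟨w, hw⟩
      have hwA : Hmap jA n w = 0 := by
        rw [LinearMap.mem_ker, Hmap_comp] at hw
        exact (hA n).1 (hw.trans (map_zero _).symm)
      have hwB : Hmap jB n w = 0 := by
        apply (hB n).1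
        rw [Hmap_comp, ← S.Hmap_comm, hwA]
        simp only [map_zero]
      obtain ⟨x, hx⟩ := S.exists_conn_of_ker w hwA hwB
      obtain ⟨a, ha⟩ := (hA (n + 1)).2 (Hmap π (n + 1) x)
      have h3 := sub_mem hx (S.conn_image a 0)
      refine ⟨⟨_, h3, ?_⟩, ?_⟩
      · change Hmap π (n + 1) (x - _) = 0
        rw [map_sub, ← ha, map_zero, add_zero, ← Hmap_comp, sub_self]
      · apply Subtype.ext
        change w - 0 = w
        rw [sub_zero]
  exact ⟨(LinearEquiv.ofBijective f hf).symm ≪≫ₗ LinearEquiv.ofBijective g hg⟩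

end IsMVSquare

lemma Hmap_fst_bijective (Q S : Type) [TopologicalSpace Q] [TopologicalSpace S]
    [ContractibleSpace S] (n : ℕ) :
    Function.Bijective (Hmap (ContinuousMap.fst : C(Q × S, Q)) n) := by
  obtain ⟨s, hs⟩ := id_nullhomotopic S
  refine Hmap_bijective_of_inverse _
    ((ContinuousMap.id Q).prodMk (ContinuousMap.const Q s)) ?_ ?_ n
  · exact ((ContinuousMap.Homotopic.refl (ContinuousMap.id Q)).prodMap hs).symm
  · exact ContinuousMap.Homotopic.refl _

/-- The complement of the origin. -/
abbrev Punct (E : Type) [Zero E] : Type := {v : E // v ≠ 0}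

/-- The kernel of the projection `Q × S → Q` on homology. -/
noncomputable abbrev kerFst (n : ℕ) (Q S : Type) [TopologicalSpace Q] [TopologicalSpace S] :
    Submodule ℤ (Hom n (Q × S)) :=
  LinearMap.ker (Hmap (ContinuousMap.fst : C(Q × S, Q)) n)

/-- The splitting of the homology of a product with a nonempty space. -/
lemma nonempty_prod_equiv (n : ℕ) (Q S : Type) [TopologicalSpace Q] [TopologicalSpace S]
    [Nonempty S] : Nonempty (Hom n (Q × S) ≃ₗ[ℤ] Hom n Q × kerFst n Q S) := by
  obtain ⟨s⟩ := ‹Nonempty S›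
  let σ : C(Q, Q × S) := (ContinuousMap.id Q).prodMk (ContinuousMap.const Q s)
  have hσ : ∀ x, Hmap (ContinuousMap.fst : C(Q × S, Q)) n (Hmap σ n x) = x := fun x => by
    rw [← Hmap_comp]
    exact Hmap_id n x
  let f : Hom n Q × kerFst n Q S →ₗ[ℤ] Hom n (Q × S) :=
    (Hmap σ n).coprod (kerFst n Q S).subtype
  refine ⟨(LinearEquiv.ofBijective f ⟨?_, fun x => ?_⟩).symm⟩
  · rw [injective_iff_map_eq_zero]
    rintro ⟨a, ⟨k, hk⟩⟩ h
    have h' : Hmap σ n a + k = 0 := h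
    have ha := congrArg (Hmap (ContinuousMap.fst : C(Q × S, Q)) n) h'
    rw [map_add, hσ, LinearMap.mem_ker.1 hk, add_zero, map_zero] at ha
    subst ha
    rw [map_zero, zero_add] at h'
    subst h'
    rfl
  · refine ⟨(Hmap ContinuousMap.fst n x, ⟨x - Hmap σ n (Hmap ContinuousMap.fst n x), ?_⟩), ?_⟩
    · rw [LinearMap.mem_ker, map_sub, hσ, sub_self]
    · change Hmap σ n (Hmap ContinuousMap.fst n x) + (x - Hmap σ n (Hmap ContinuousMap.fst n x)) = x
      exact add_sub_cancel _ _

lemma nonempty_ker_congr {π : C(X, Q)} {π' : C(Y, Q)} (f : C(X, Y)) (h : π'.comp f = π) (n : ℕ)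
    (hf : Function.Bijective (Hmap f n)) :
    Nonempty (LinearMap.ker (Hmap π n) ≃ₗ[ℤ] LinearMap.ker (Hmap π' n)) := by
  refine ⟨(LinearEquiv.ofBijective _ hf).ofSubmodules _ _ ?_⟩
  subst h
  ext y
  constructor
  · rintro ⟨x, hx, rfl⟩
    exact (Hmap_comp _ _ _ _).symm.trans hx
  · intro hy
    obtain ⟨x, rfl⟩ := hf.2 y
    exact ⟨x, (Hmap_comp _ _ _ _).trans hy, rfl⟩

lemma nonempty_kerFst_congr (n : ℕ) (Q : Type) [TopologicalSpace Q] {S S' : Type}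
    [TopologicalSpace S] [TopologicalSpace S'] (e : S ≃ₜ S') :
    Nonempty (kerFst n Q S ≃ₗ[ℤ] kerFst n Q S') :=
  nonempty_ker_congr ((ContinuousMap.id Q).prodMap (e : C(S, S'))) (by ext1 x; rfl) n
    (Hmap_bijective_of_inverse _ ((ContinuousMap.id Q).prodMap (e.symm : C(S', S)))
      (by
        convert ContinuousMap.Homotopic.refl _ using 1
        ext1 x
        exact Prod.ext rfl (e.symm_apply_apply x.2).symm)
      (by
        convert ContinuousMap.Homotopic.refl _ using 1
        ext1 x
        exact Prod.ext rfl (e.apply_symm_apply x.2).symm) n)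

/-- The inclusion of a product with a subspace. -/
def prodIncl (Q : Type) [TopologicalSpace Q] {P : Type} [TopologicalSpace P] {p q : P → Prop}
    (h : ∀ x, p x → q x) : C(Q × {x // p x}, Q × {x // q x}) :=
  (ContinuousMap.id Q).prodMap ⟨Subtype.map id h, continuous_id.subtype_map h⟩

lemma isOpenEmbedding_prodIncl (Q : Type) [TopologicalSpace Q] {P : Type} [TopologicalSpace P]
    {p q : P → Prop} (h : ∀ x, p x → q x) (hp : IsOpen {x | p x}) :
    Topology.IsOpenEmbedding (prodIncl Q h) := by
  refine Topology.IsOpenEmbedding.prodMap Topology.IsOpenEmbedding.id ?_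
  refine ⟨Topology.IsEmbedding.of_comp (continuous_id.subtype_map h) continuous_subtype_val
    Topology.IsEmbedding.subtypeVal, ?_⟩
  convert hp.preimage (continuous_subtype_val (p := q))
  ext ⟨x, hx⟩
  exact ⟨fun ⟨y, hy⟩ => by
    have : y.1 = x := congrArg Subtype.val hy
    exact this ▸ y.2, fun hx' => ⟨⟨x, hx'⟩, rfl⟩⟩

/-- A product with a space covered by two open subspaces. -/
lemma isMVSquare_prod (Q : Type) [TopologicalSpace Q] {P : Type} [TopologicalSpace P]
    {a b w x : P → Prop} (ha : IsOpen {t | a t}) (hb : IsOpen {t | b t})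
    (hx : ∀ t, x t ↔ a t ∨ b t) (hw : ∀ t, w t ↔ a t ∧ b t) :
    IsMVSquare (prodIncl Q (p := w) (q := a) fun t h => ((hw t).1 h).1)
      (prodIncl Q (p := w) (q := b) fun t h => ((hw t).1 h).2)
      (prodIncl Q (p := a) (q := x) fun t h => (hx t).2 (Or.inl h))
      (prodIncl Q (p := b) (q := x) fun t h => (hx t).2 (Or.inr h)) where
  comm _ := rfl
  openA := isOpenEmbedding_prodIncl Q _ ha
  openB := isOpenEmbedding_prodIncl Q _ hb
  cover := by
    rintro ⟨q, t, ht⟩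
    rcases (hx t).1 ht with h | h
    · exact Or.inl ⟨(q, ⟨t, h⟩), rfl⟩
    · exact Or.inr ⟨(q, ⟨t, h⟩), rfl⟩
  embedding := (isOpenEmbedding_prodIncl Q _ (by
    have : {t | w t} = {t | a t} ∩ {t | b t} := Set.ext hw
    rw [this]
    exact ha.inter hb)).isEmbedding
  exists_of_eq := by
    rintro ⟨q, t, ht⟩ ⟨q', t', ht'⟩ h
    have h1 : q = q' := congrArg Prod.fst h
    have h2 : t = t' := congrArg (fun z => z.2.1) h
    subst h1 h2
    exact ⟨(q, ⟨t, (hw t).2 ⟨ht, ht'⟩⟩), rfl, rfl⟩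

end Products

section PuncturedSpace

variable {X Y W A B Q : Type} [TopologicalSpace X] [TopologicalSpace Y]
  [TopologicalSpace W] [TopologicalSpace A] [TopologicalSpace B] [TopologicalSpace Q]

lemma Hmap_surjective_of_section (j : C(W, A)) (π : C(A, Q)) (s : C(Q, W))
    (h : (π.comp j).comp s = ContinuousMap.id Q) (n : ℕ) (hπ : Function.Injective (Hmap π n)) :
    Function.Surjective (Hmap j n) := by
  intro x
  refine ⟨Hmap s n (Hmap π n x), hπ ?_⟩
  rw [← Hmap_comp, ← Hmap_comp, h, Hmap_id]

lemma contractibleSpace_subtype {E : Type} [AddCommGroup E] [Module ℝ E] [TopologicalSpace E]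
    [ContinuousAdd E] [ContinuousSMul ℝ E] {p : E → Prop} (x : E) (hx : p x)
    (h : StarConvex ℝ x {y | p y}) :
    ContractibleSpace {y // p y} :=
  h.contractibleSpace ⟨x, hx⟩

lemma nonempty_kerFst_punct_real (Q : Type) [TopologicalSpace Q] (n : ℕ) :
    Nonempty (kerFst n Q (Punct ℝ) ≃ₗ[ℤ] Hom n Q) := by
  have ha : IsOpen {t : ℝ | 0 < t} := isOpen_lt continuous_const continuous_id
  have hb : IsOpen {t : ℝ | t < 0} := isOpen_lt continuous_id continuous_const
  have S := isMVSquare_prod Q (x := fun t : ℝ => t ≠ 0) (w := fun _ => False) ha hb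
    (fun t => ne_iff_lt_or_gt.trans or_comm) (fun t => ⟨False.elim, fun h => lt_asymm h.1 h.2⟩)
  have : IsEmpty (Q × {t : ℝ // False}) := ⟨fun x => x.2.2⟩
  have : ContractibleSpace {t : ℝ // 0 < t} :=
    contractibleSpace_subtype 1 one_pos ((convex_Ioi 0).starConvex (Set.mem_Ioi.2 one_pos))
  have : ContractibleSpace {t : ℝ // t < 0} :=
    contractibleSpace_subtype (-1) (by norm_num)
      ((convex_Iio 0).starConvex (Set.mem_Iio.2 (by norm_num)))
  exact S.nonempty_ker_equiv_of_isEmpty ContinuousMap.fst n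
    (Hmap_fst_bijective Q {t : ℝ // 0 < t} n) (Hmap_fst_bijective Q {t : ℝ // t < 0} n)

section Suspension

variable (Q) (F : Type) [NormedAddCommGroup F] [NormedSpace ℝ F]

/-- Nonzero first coordinate. -/
def prodRealHomeomorph : Q × {p : F × ℝ // p.1 ≠ 0} ≃ₜ (Q × Punct F) × ℝ where
  toFun z := ((z.1, ⟨z.2.1.1, z.2.2⟩), z.2.1.2)
  invFun z := (z.1.1, ⟨(z.1.2.1, z.2), z.1.2.2⟩)
  left_inv _ := rfl
  right_inv _ := rfl
  continuous_toFun := by fun_prop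
  continuous_invFun := by fun_prop

lemma contractibleSpace_upper : ContractibleSpace {p : F × ℝ // p.1 ≠ 0 ∨ 0 < p.2} := by
  refine contractibleSpace_subtype (0, 1) (Or.inr one_pos) ?_
  rintro ⟨v, t⟩ h a b ha hb hab
  simp only [Set.mem_ofPred_eq, Prod.smul_mk, smul_zero, Prod.mk_add_mk, zero_add, smul_eq_mul,
    mul_one] at h ⊢
  rcases hb.eq_or_lt with rfl | hb
  · right
    linarith
  · rcases h with h | h
    · exact Or.inl (smul_ne_zero hb.ne' h)
    · right
      positivity

lemma contractibleSpace_lower : ContractibleSpace {p : F × ℝ // p.1 ≠ 0 ∨ p.2 < 0} := by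
  refine contractibleSpace_subtype (0, -1) (Or.inr (by norm_num)) ?_
  rintro ⟨v, t⟩ h a b ha hb hab
  simp only [Set.mem_ofPred_eq, Prod.smul_mk, smul_zero, Prod.mk_add_mk, zero_add, smul_eq_mul,
    mul_neg, mul_one] at h ⊢
  rcases hb.eq_or_lt with rfl | hb
  · right
    linarith
  · rcases h with h | h
    · exact Or.inl (smul_ne_zero hb.ne' h)
    · right
      nlinarith

lemma kerFst_suspension [Nontrivial F] :
    Subsingleton (kerFst 0 Q (Punct (F × ℝ))) ∧
    ∀ n, Nonempty (kerFst (n + 1) Q (Punct (F × ℝ)) ≃ₗ[ℤ] kerFst n Q (Punct F)) := by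
  have h1 : IsOpen {p : F × ℝ | p.1 ≠ 0} := isOpen_ne_fun continuous_fst continuous_const
  have ha : IsOpen {p : F × ℝ | p.1 ≠ 0 ∨ 0 < p.2} :=
    h1.union (isOpen_lt continuous_const continuous_snd)
  have hb : IsOpen {p : F × ℝ | p.1 ≠ 0 ∨ p.2 < 0} :=
    h1.union (isOpen_lt continuous_snd continuous_const)
  have S := isMVSquare_prod Q (x := fun p : F × ℝ => p ≠ 0) (w := fun p => p.1 ≠ 0) ha hb
    (fun p => by
      rw [Ne, Prod.ext_iff, not_and_or, ← or_or_distrib_left, or_comm (a := 0 < p.2),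
        ← ne_iff_lt_or_gt]
      rfl)
    (fun p => by
      rw [← or_and_left]
      exact ⟨Or.inl, fun h => h.elim id fun h => absurd h.1 h.2.not_gt⟩)
  obtain ⟨v, hv⟩ := exists_ne (0 : F)
  have := contractibleSpace_upper F
  have := contractibleSpace_lower F
  have hA := Hmap_fst_bijective Q {p : F × ℝ // p.1 ≠ 0 ∨ 0 < p.2}
  have hB := Hmap_fst_bijective Q {p : F × ℝ // p.1 ≠ 0 ∨ p.2 < 0}
  let s : C(Q, Q × {p : F × ℝ // p.1 ≠ 0}) :=
    (ContinuousMap.id Q).prodMk (ContinuousMap.const Q ⟨(v, 0), hv⟩)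
  have hjA := fun n => Hmap_surjective_of_section (prodIncl Q (p := fun p : F × ℝ => p.1 ≠ 0)
    (q := fun p => p.1 ≠ 0 ∨ 0 < p.2) fun _ h => Or.inl h) ContinuousMap.fst s rfl n (hA n).1
  have hjB := fun n => Hmap_surjective_of_section (prodIncl Q (p := fun p : F × ℝ => p.1 ≠ 0)
    (q := fun p => p.1 ≠ 0 ∨ p.2 < 0) fun _ h => Or.inl h) ContinuousMap.fst s rfl n (hB n).1
  refine ⟨S.subsingleton_ker_zero ContinuousMap.fst (hA 0) (hjA 0) (hjB 0), fun n => ?_⟩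
  obtain ⟨e⟩ := S.nonempty_ker_equiv ContinuousMap.fst hA hB hjA hjB n
  let f : C(Q × {p : F × ℝ // p.1 ≠ 0}, Q × Punct F) :=
    ContinuousMap.fst.comp
      (prodRealHomeomorph Q F : C(Q × {p : F × ℝ // p.1 ≠ 0}, (Q × Punct F) × ℝ))
  have hf : Function.Bijective (Hmap f n) := by
    have h : ⇑(Hmap f n) = Hmap ContinuousMap.fst n ∘
        Hmap (prodRealHomeomorph Q F : C(Q × {p : F × ℝ // p.1 ≠ 0}, (Q × Punct F) × ℝ)) n :=
      funext fun x => Hmap_comp _ _ _ _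
    rw [h]
    exact (Hmap_fst_bijective (Q × Punct F) ℝ n).comp (Hmap_homeomorph_bijective _ n)
  obtain ⟨e'⟩ := nonempty_ker_congr (π' := (ContinuousMap.fst : C(Q × Punct F, Q))) f rfl n hf
  exact ⟨e.trans e'⟩

end Suspension

/-- The complement of the origin is preserved by continuous linear equivalences. -/
def punctHomeomorph {E F : Type} [NormedAddCommGroup E] [NormedSpace ℝ E]
    [NormedAddCommGroup F] [NormedSpace ℝ F] (e : E ≃L[ℝ] F) : Punct E ≃ₜ Punct F :=
  e.toHomeomorph.subtype fun _ => (e.map_eq_zero_iff.not).symm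

/-- The homology of a product with a punctured vector space, relative to the first factor. -/
theorem kerFst_punct (Q : Type) [TopologicalSpace Q] (n : ℕ) :
    ∀ (E : Type) [NormedAddCommGroup E] [NormedSpace ℝ E], Module.finrank ℝ E = n + 1 → ∀ d,
    (d < n → Subsingleton (kerFst d Q (Punct E))) ∧
    Nonempty (kerFst (d + n) Q (Punct E) ≃ₗ[ℤ] Hom d Q) := by
  induction n with
  | zero =>
    intro E _ _ hE d
    have : FiniteDimensional ℝ E := Module.finite_of_finrank_eq_succ hE
    let e : E ≃L[ℝ] ℝ := ContinuousLinearEquiv.ofFinrankEq (by rw [hE, Module.finrank_self])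
    refine ⟨fun h => absurd h d.not_lt_zero, ?_⟩
    obtain ⟨e1⟩ := nonempty_kerFst_congr d Q (punctHomeomorph e)
    obtain ⟨e2⟩ := nonempty_kerFst_punct_real Q d
    exact ⟨e1.trans e2⟩
  | succ n ih =>
    intro E _ _ hE d
    have : FiniteDimensional ℝ E := Module.finite_of_finrank_eq_succ hE
    let e : E ≃L[ℝ] (Fin (n + 1) → ℝ) × ℝ := ContinuousLinearEquiv.ofFinrankEq (by simp [hE])
    have e1 := fun k => nonempty_kerFst_congr k Q (punctHomeomorph e)
    obtain ⟨h0, h1⟩ := kerFst_suspension Q (Fin (n + 1) → ℝ)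
    constructor
    · intro hd
      cases d with
      | zero =>
        obtain ⟨e1⟩ := e1 0
        exact e1.toEquiv.subsingleton
      | succ d =>
        obtain ⟨e1⟩ := e1 (d + 1)
        obtain ⟨e2⟩ := h1 d
        have := (ih (Fin (n + 1) → ℝ) (by simp) d).1 (by omega)
        exact (e1.trans e2).toEquiv.subsingleton
    · obtain ⟨e1⟩ := e1 (d + n + 1)
      obtain ⟨e2⟩ := h1 (d + n)
      obtain ⟨e3⟩ := (ih (Fin (n + 1) → ℝ) (by simp) d).2
      exact ⟨(e1.trans e2).trans e3⟩

/-- Finitely generated free homology. -/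
def FreeHom (X : Type) [TopologicalSpace X] : Prop :=
  ∀ d, Module.Free ℤ (Hom d X) ∧ Module.Finite ℤ (Hom d X)

/-- The Betti numbers. -/
noncomputable def betti (X : Type) [TopologicalSpace X] (d : ℕ) : ℕ := Module.finrank ℤ (Hom d X)

lemma FreeHom.of_equiv (h : FreeHom X) (e : ∀ d, Nonempty (Hom d X ≃ₗ[ℤ] Hom d Y)) :
    FreeHom Y := fun d => by
  obtain ⟨e⟩ := e d
  have := (h d).1
  have := (h d).2
  exact ⟨Module.Free.of_equiv e, Module.Finite.equiv e⟩

lemma FreeHom.prod_punct (h : FreeHom Q) {E : Type} [NormedAddCommGroup E] [NormedSpace ℝ E]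
    {n : ℕ} (hE : Module.finrank ℝ E = n + 1) :
    FreeHom (Q × Punct E) ∧
    ∀ d, betti (Q × Punct E) d = betti Q d + if n ≤ d then betti Q (d - n) else 0 := by
  have : Nontrivial E := Module.nontrivial_of_finrank_pos (R := ℝ) (by omega)
  have : Nonempty (Punct E) := let ⟨v, hv⟩ := exists_ne (0 : E); ⟨⟨v, hv⟩⟩
  have key : ∀ d, (Module.Free ℤ (Hom d (Q × Punct E)) ∧ Module.Finite ℤ (Hom d (Q × Punct E))) ∧
      betti (Q × Punct E) d = betti Q d + if n ≤ d then betti Q (d - n) else 0 := by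
    intro d
    have := (h d).1
    have := (h d).2
    obtain ⟨e⟩ := nonempty_prod_equiv d Q (Punct E)
    have hk : (Module.Free ℤ (kerFst d Q (Punct E)) ∧ Module.Finite ℤ (kerFst d Q (Punct E))) ∧
        Module.finrank ℤ (kerFst d Q (Punct E)) = if n ≤ d then betti Q (d - n) else 0 := by
      by_cases hd : n ≤ d
      · obtain ⟨c, rfl⟩ := Nat.exists_eq_add_of_le' hd
        obtain ⟨e'⟩ := (kerFst_punct Q n E hE c).2
        have := (h c).1
        have := (h c).2
        refine ⟨⟨Module.Free.of_equiv e'.symm, Module.Finite.equiv e'.symm⟩, ?_⟩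
        rw [if_pos hd, Nat.add_sub_cancel]
        exact e'.finrank_eq
      · have := (kerFst_punct Q n E hE d).1 (by omega)
        refine ⟨⟨inferInstance, inferInstance⟩, ?_⟩
        rw [if_neg hd]
        exact Module.finrank_zero_of_subsingleton
    obtain ⟨⟨_, _⟩, hr⟩ := hk
    refine ⟨⟨Module.Free.of_equiv e.symm, Module.Finite.equiv e.symm⟩, ?_⟩
    rw [← hr]
    exact e.finrank_eq.trans Module.finrank_prod
  exact ⟨fun d => (key d).1, fun d => (key d).2⟩

end PuncturedSpace

section Tubes

/-- Assignments taking distinct values at the ends of each edge. -/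
def IsConf {V α : Type} {m : ℕ} (g : Fin m → V × V) (x : V → α) : Prop :=
  ∀ k, x (g k).1 ≠ x (g k).2

/-- The configuration space of a family of edges. -/
abbrev Conf {V : Type} {m : ℕ} (g : Fin m → V × V) (E : Type) : Type :=
  {x : V → E // IsConf g x}

lemma isConf_cons {V α : Type} {m : ℕ} (e : V × V) (g : Fin m → V × V) (x : V → α) :
    IsConf (Fin.cons e g : Fin (m + 1) → V × V) x ↔ x e.1 ≠ x e.2 ∧ IsConf g x :=
  Fin.forall_fin_succ

section Contraction

variable {V : Type} [DecidableEq V] {i j : V}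

/-- The map identifying the vertex `j` with the vertex `i`. -/
def contr (hij : i ≠ j) (v : V) : {v // v ≠ j} :=
  if h : v = j then ⟨i, hij⟩ else ⟨v, h⟩

lemma contr_left (hij : i ≠ j) : contr hij i = ⟨i, hij⟩ := dif_neg hij

lemma contr_right (hij : i ≠ j) : contr hij j = ⟨i, hij⟩ := dif_pos rfl

lemma contr_of_ne (hij : i ≠ j) {v : V} (h : v ≠ j) : contr hij v = ⟨v, h⟩ := dif_neg h

/-- The contraction of a family of edges. -/
def contrEdges (hij : i ≠ j) {m : ℕ} (g : Fin m → V × V) (k : Fin m) :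
    {v // v ≠ j} × {v // v ≠ j} :=
  (contr hij (g k).1, contr hij (g k).2)

lemma isConf_contrEdges {α : Type} (hij : i ≠ j) {m : ℕ} (g : Fin m → V × V)
    (z : {v // v ≠ j} → α) : IsConf (contrEdges hij g) z ↔ IsConf g (z ∘ contr hij) :=
  Iff.rfl

lemma comp_contr_of_eq {α : Type} (hij : i ≠ j) {x : V → α} (h : x i = x j) :
    (fun v : {v // v ≠ j} => x v) ∘ contr hij = x := by
  funext v
  by_cases hv : v = j
  · subst hv
    rw [Function.comp_apply, contr_right, h]
  · rw [Function.comp_apply, contr_of_ne hij hv]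

lemma comp_contr_comp_val {α : Type} (hij : i ≠ j) (z : {v // v ≠ j} → α) :
    (fun v : {v // v ≠ j} => (z ∘ contr hij) v) = z := by
  funext v
  rw [Function.comp_apply, contr_of_ne hij v.2]

end Contraction

lemma isOpen_isConf {V E : Type} [NormedAddCommGroup E] {m : ℕ} (g : Fin m → V × V) :
    IsOpen {x : V → E | IsConf g x} := by
  have : {x : V → E | IsConf g x} = ⋂ k, {x | x (g k).1 ≠ x (g k).2} := by
    ext x
    simp [IsConf]
  rw [this]
  exact isOpen_iInter_of_finite fun k => isOpen_ne_fun (continuous_apply _) (continuous_apply _)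

lemma Hmap_prodMap_bijective (Q : Type) [TopologicalSpace Q] {X Y : Type} [TopologicalSpace X]
    [TopologicalSpace Y] (f : C(X, Y)) (g : C(Y, X))
    (hgf : (g.comp f).Homotopic (ContinuousMap.id X))
    (hfg : (f.comp g).Homotopic (ContinuousMap.id Y)) (n : ℕ) :
    Function.Bijective (Hmap ((ContinuousMap.id Q).prodMap f) n) :=
  Hmap_bijective_of_inverse ((ContinuousMap.id Q).prodMap f) ((ContinuousMap.id Q).prodMap g)
    ((ContinuousMap.Homotopic.refl (ContinuousMap.id Q)).prodMap hgf)
    ((ContinuousMap.Homotopic.refl (ContinuousMap.id Q)).prodMap hfg) n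

section Tube

variable {V : Type} [DecidableEq V] {E : Type} [NormedAddCommGroup E] [NormedSpace ℝ E]

/-- Scaling the displacement from the `i`th to the `j`th point. -/
noncomputable def scale (i j : V) (s : ℝ) (x : V → E) : V → E :=
  Function.update x j (x i + s • (x j - x i))

variable {i j : V}

lemma scale_left (hij : i ≠ j) (s : ℝ) (x : V → E) : scale i j s x i = x i :=
  Function.update_of_ne hij _ _

lemma scale_right (s : ℝ) (x : V → E) : scale i j s x j = x i + s • (x j - x i) :=
  Function.update_self _ _ _

lemma scale_of_ne (s : ℝ) (x : V → E) {v : V} (hv : v ≠ j) : scale i j s x v = x v :=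
  Function.update_of_ne hv _ _

lemma scale_sub (hij : i ≠ j) (s : ℝ) (x : V → E) :
    scale i j s x j - scale i j s x i = s • (x j - x i) := by
  rw [scale_left hij, scale_right, add_sub_cancel_left]

lemma scale_scale (hij : i ≠ j) (s t : ℝ) (x : V → E) :
    scale i j s (scale i j t x) = scale i j (s * t) x := by
  rw [scale, scale_sub hij, scale_left hij, smul_smul, scale, scale, Function.update_idem]

lemma scale_one (x : V → E) : scale i j 1 x = x := by
  rw [scale, one_smul, add_sub_cancel, Function.update_eq_self]

lemma scale_of_eq {x : V → E} (h : x i = x j) (s : ℝ) : scale i j s x = x := by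
  rw [scale, h, sub_self, smul_zero, add_zero, Function.update_eq_self]

lemma scale_zero (hij : i ≠ j) (x : V → E) :
    scale i j 0 x = (fun v : {v // v ≠ j} => x v) ∘ contr hij := by
  funext v
  by_cases hv : v = j
  · subst hv
    rw [Function.comp_apply, contr_right, scale_right, zero_smul, add_zero]
  · rw [Function.comp_apply, contr_of_ne hij hv, scale_of_ne _ _ hv]

@[fun_prop]
lemma Continuous.scale {X : Type} [TopologicalSpace X] {s : X → ℝ} {x : X → V → E}
    (hs : Continuous s) (hx : Continuous x) : Continuous fun p => scale i j (s p) (x p) := by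
  unfold SingularChains.scale
  exact hx.update j (by fun_prop)

/-- The configurations in which the `j`th point can be moved to the `i`th along a segment. -/
def IsTube (i j : V) {m : ℕ} (g : Fin m → V × V) (x : V → E) : Prop :=
  ∀ s : unitInterval, IsConf g (scale i j s x)

lemma isOpen_isTube {m : ℕ} (g : Fin m → V × V) : IsOpen {x : V → E | IsTube i j g x} := by
  have h : IsClosed {p : unitInterval × (V → E) | ¬ IsConf g (scale i j p.1 p.2)} := by
    have h' : IsOpen {p : unitInterval × (V → E) | IsConf g (scale i j p.1 p.2)} :=
      (isOpen_isConf g).preimage (f := fun p : unitInterval × (V → E) => scale i j p.1 p.2)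
        (by fun_prop)
    exact h'.isClosed_compl
  rw [← isClosed_compl_iff]
  convert isClosedMap_snd_of_compactSpace _ h
  ext x
  simp only [IsTube, Set.mem_compl_iff, Set.mem_ofPred_eq, not_forall, Set.mem_image, Prod.exists,
    exists_eq_right]

lemma IsTube.isConf {m : ℕ} {g : Fin m → V × V} {x : V → E} (h : IsTube i j g x) :
    IsConf g x := by
  have := h 1
  rwa [Set.Icc.coe_one, scale_one] at this

lemma IsTube.scale (hij : i ≠ j) {m : ℕ} {g : Fin m → V × V} {x : V → E} (h : IsTube i j g x)
    (s : unitInterval) : IsTube i j g (scale i j s x) := fun t => by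
  rw [scale_scale hij]
  exact h (t * s)

lemma IsTube.isConf_contrEdges (hij : i ≠ j) {m : ℕ} {g : Fin m → V × V} {x : V → E}
    (h : IsTube i j g x) : IsConf (contrEdges hij g) fun v : {v // v ≠ j} => x v := by
  have := h 0
  rwa [Set.Icc.coe_zero, scale_zero hij] at this

lemma isTube_comp_contr (hij : i ≠ j) {m : ℕ} {g : Fin m → V × V} {z : {v // v ≠ j} → E}
    (h : IsConf (contrEdges hij g) z) : IsTube i j g (z ∘ contr hij) := fun s => by
  rw [scale_of_eq]
  · exact h
  · simp only [Function.comp_apply, contr_left, contr_right]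

/-- Restricting a tube configuration to the remaining points. -/
def tubeToConf (hij : i ≠ j) {m : ℕ} (g : Fin m → V × V) :
    C({x : V → E // IsTube i j g x}, Conf (contrEdges hij g) E) where
  toFun x := ⟨fun v => x.1 v, x.2.isConf_contrEdges hij⟩
  continuous_toFun := Continuous.subtype_mk
    (continuous_pi fun v => (continuous_apply v.1).comp continuous_subtype_val) _

lemma Hmap_tubeToConf_bijective (Q : Type) [TopologicalSpace Q] (hij : i ≠ j) {m : ℕ}
    (g : Fin m → V × V) (n : ℕ) :
    Function.Bijective (Hmap ((ContinuousMap.id Q).prodMap (tubeToConf (E := E) hij g)) n) := by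
  let f' : C(Conf (contrEdges hij g) E, {x : V → E // IsTube i j g x}) :=
    ⟨fun z => ⟨z.1 ∘ contr hij, isTube_comp_contr hij z.2⟩, by
      refine Continuous.subtype_mk (continuous_pi fun v => ?_) _
      exact (continuous_apply _).comp continuous_subtype_val⟩
  refine Hmap_prodMap_bijective Q _ f' ?_ ?_ n
  · refine ⟨⟨⟨fun p => ⟨scale i j p.1 p.2.1, p.2.2.scale hij p.1⟩, ?_⟩, fun x => ?_, fun x => ?_⟩⟩
    · exact Continuous.subtype_mk (by fun_prop) _
    · exact Subtype.ext ((congrArg (scale i j · x.1) Set.Icc.coe_zero).trans (scale_zero hij _))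
    · exact Subtype.ext ((congrArg (scale i j · x.1) Set.Icc.coe_one).trans (scale_one _))
  · convert ContinuousMap.Homotopic.refl _
    ext1 z
    exact Subtype.ext (comp_contr_comp_val hij z.1).symm

end Tube

end Tubes

section Collisions

section Collision

variable {V : Type} {E : Type} [NormedAddCommGroup E]

lemma continuous_point {p : (V → E) → Prop} (v : V) : Continuous fun x : {x // p x} => x.1 v :=
  (continuous_apply v).comp continuous_subtype_val

lemma one_le_one_add_sum {m : ℕ} (h : Fin m → V × V) (z : V → E) :
    1 ≤ 1 + ∑ k, ‖z (h k).1 - z (h k).2‖⁻¹ :=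
  le_add_of_nonneg_right (Finset.sum_nonneg fun _ _ => inv_nonneg.2 (norm_nonneg _))

/-- A positive factor making a vector smaller than all the distances between the ends of edges. -/
noncomputable def shrink {m : ℕ} (h : Fin m → V × V) (y : E) (z : V → E) : ℝ :=
  (1 + ‖y‖)⁻¹ * (1 + ∑ k, ‖z (h k).1 - z (h k).2‖⁻¹)⁻¹

lemma shrink_pos {m : ℕ} (h : Fin m → V × V) (y : E) (z : V → E) : 0 < shrink h y z := by
  have := one_le_one_add_sum h z
  unfold shrink
  positivity

lemma shrink_le_one {m : ℕ} (h : Fin m → V × V) (y : E) (z : V → E) : shrink h y z ≤ 1 := by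
  have h1 := one_le_one_add_sum h z
  refine mul_le_one₀ (inv_le_one_of_one_le₀ ?_) (by positivity) (inv_le_one_of_one_le₀ h1)
  exact le_add_of_nonneg_right (norm_nonneg _)

lemma norm_shrink_smul_lt [NormedSpace ℝ E] {m : ℕ} {h : Fin m → V × V} (y : E)
    {z : V → E} (hz : IsConf h z)
    (k : Fin m) : ‖shrink h y z • y‖ < ‖z (h k).1 - z (h k).2‖ := by
  have h1 := one_le_one_add_sum h z
  have h2 : 0 < ‖z (h k).1 - z (h k).2‖ := norm_pos_iff.2 (sub_ne_zero.2 (hz k))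
  have h3 : ‖z (h k).1 - z (h k).2‖⁻¹ < 1 + ∑ k, ‖z (h k).1 - z (h k).2‖⁻¹ := by
    refine (Finset.single_le_sum (f := fun k => ‖z (h k).1 - z (h k).2‖⁻¹)
      (fun _ _ => inv_nonneg.2 (norm_nonneg _)) (Finset.mem_univ k)).trans_lt ?_
    exact lt_one_add _
  rw [norm_smul, Real.norm_of_nonneg (shrink_pos h y z).le, shrink]
  calc (1 + ‖y‖)⁻¹ * (1 + ∑ k, ‖z (h k).1 - z (h k).2‖⁻¹)⁻¹ * ‖y‖
      = (‖y‖ / (1 + ‖y‖)) * (1 + ∑ k, ‖z (h k).1 - z (h k).2‖⁻¹)⁻¹ := by ring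
    _ ≤ 1 * (1 + ∑ k, ‖z (h k).1 - z (h k).2‖⁻¹)⁻¹ := by
      refine mul_le_mul_of_nonneg_right ?_ (by positivity)
      exact div_le_one_of_le₀ (by linarith) (by positivity)
    _ < ‖z (h k).1 - z (h k).2‖ := by
      rw [one_mul]
      exact inv_lt_of_inv_lt₀ h2 h3

lemma continuous_shrink {m : ℕ} (h : Fin m → V × V) :
    Continuous fun p : Punct E × Conf h E => shrink h p.1.1 p.2.1 := by
  have h2 : ∀ (p : Punct E × Conf h E) k, ‖p.2.1 (h k).1 - p.2.1 (h k).2‖ ≠ 0 := fun p k =>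
    norm_ne_zero_iff.2 (sub_ne_zero.2 (p.2.2 k))
  refine Continuous.mul (Continuous.inv₀ (by fun_prop) fun p => ?_)
    (Continuous.inv₀ (continuous_const.add (continuous_finsetSum _ fun k _ =>
      Continuous.inv₀ (((continuous_point _).sub (continuous_point _)).comp continuous_snd).norm
        fun p => h2 p k)) fun p => ?_)
  · positivity
  · exact (zero_lt_one.trans_le (one_le_one_add_sum h p.2.1)).ne'

variable [DecidableEq V] {i j : V}

/-- Splitting off the `j`th point from the `i`th by the vector `δ`. -/
def splitOff (hij : i ≠ j) (z : {v // v ≠ j} → E) (δ : E) : V → E :=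
  Function.update (z ∘ contr hij) j (z ⟨i, hij⟩ + δ)

lemma splitOff_left (hij : i ≠ j) (z : {v // v ≠ j} → E) (δ : E) :
    splitOff hij z δ i = z ⟨i, hij⟩ := by
  rw [splitOff, Function.update_of_ne hij, Function.comp_apply, contr_left]

lemma splitOff_right (hij : i ≠ j) (z : {v // v ≠ j} → E) (δ : E) :
    splitOff hij z δ j = z ⟨i, hij⟩ + δ :=
  Function.update_self _ _ _

lemma splitOff_of_ne (hij : i ≠ j) (z : {v // v ≠ j} → E) (δ : E) {v : V} (hv : v ≠ j) :
    splitOff hij z δ v = z ⟨v, hv⟩ := by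
  rw [splitOff, Function.update_of_ne hv, Function.comp_apply, contr_of_ne]

lemma isConf_splitOff (hij : i ≠ j) {m : ℕ} {g : Fin m → V × V} {z : {v // v ≠ j} → E} {δ : E}
    (h : ∀ k, ‖δ‖ < ‖z (contrEdges hij g k).1 - z (contrEdges hij g k).2‖) :
    IsConf g (splitOff hij z δ) := by
  intro k hk
  have hval : ∀ v, splitOff hij z δ v = z (contr hij v) + if v = j then δ else 0 := fun v => by
    split_ifs with hv
    · subst hv
      rw [splitOff_right, contr_right]
    · rw [splitOff_of_ne hij _ _ hv, contr_of_ne hij hv, add_zero]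
  rw [hval, hval] at hk
  refine (h k).not_ge ?_
  have h1 : z (contr hij (g k).1) - z (contr hij (g k).2) =
      (if (g k).2 = j then δ else 0) - if (g k).1 = j then δ else 0 := by
    rw [sub_eq_sub_iff_add_eq_add, hk, add_comm]
  change ‖z (contr hij (g k).1) - z (contr hij (g k).2)‖ ≤ _
  rw [h1]
  split_ifs <;> simp

variable [NormedSpace ℝ E]

lemma splitOff_restrict (hij : i ≠ j) (x : V → E) (c : ℝ) :
    splitOff hij (fun v => x v) (c • (x j - x i)) = scale i j c x := by
  funext v
  by_cases hv : v = j
  · subst hv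
    rw [splitOff_right, scale_right]
  · rw [splitOff_of_ne hij _ _ hv, scale_of_ne _ _ hv]

lemma scale_splitOff (hij : i ≠ j) (z : {v // v ≠ j} → E) (δ : E) (c : ℝ) :
    scale i j c (splitOff hij z δ) = splitOff hij z (c • δ) := by
  rw [scale, splitOff_right, splitOff_left, add_sub_cancel_left, splitOff, splitOff,
    Function.update_idem]

/-- Configurations in the tube with distinct `i`th and `j`th points. -/
abbrev IsTubeNe (i j : V) {m : ℕ} (g : Fin m → V × V) (x : V → E) : Prop :=
  x i ≠ x j ∧ IsTube i j g x

lemma IsTubeNe.scale (hij : i ≠ j) {m : ℕ} {g : Fin m → V × V} {x : V → E}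
    (h : IsTubeNe i j g x) {c : ℝ} (h0 : 0 < c) (h1 : c ≤ 1) :
    IsTubeNe i j g (scale i j c x) := by
  refine ⟨fun he => ?_, h.2.scale hij ⟨c, h0.le, h1⟩⟩
  have h2 := scale_sub hij c x
  rw [he, sub_self, eq_comm, smul_eq_zero, sub_eq_zero] at h2
  exact h2.elim h0.ne' fun h' => h.1 h'.symm

lemma isTubeNe_splitOff (hij : i ≠ j) {m : ℕ} {g : Fin m → V × V} (y : Punct E)
    (z : Conf (contrEdges hij g) E) :
    IsTubeNe i j g (splitOff hij z.1 (shrink (contrEdges hij g) y.1 z.1 • y.1)) := by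
  refine ⟨?_, fun s => ?_⟩
  · rw [splitOff_left, splitOff_right, Ne, left_eq_add]
    exact smul_ne_zero (shrink_pos _ _ _).ne' y.2
  · rw [scale_splitOff]
    refine isConf_splitOff hij fun k => ?_
    refine lt_of_le_of_lt ?_ (norm_shrink_smul_lt y.1 z.2 k)
    rw [norm_smul, Real.norm_of_nonneg s.2.1]
    exact mul_le_of_le_one_left (norm_nonneg _) s.2.2

/-- The displacement and the remaining points. -/
def tubeNeToProd (hij : i ≠ j) {m : ℕ} (g : Fin m → V × V) :
    C({x : V → E // IsTubeNe i j g x}, Punct E × Conf (contrEdges hij g) E) where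
  toFun x := (⟨x.1 j - x.1 i, sub_ne_zero.2 x.2.1.symm⟩,
    ⟨fun v => x.1 v, x.2.2.isConf_contrEdges hij⟩)
  continuous_toFun := (Continuous.subtype_mk
    ((continuous_point j).sub (continuous_point i)) _).prodMk (Continuous.subtype_mk
    (continuous_pi fun v => (continuous_apply v.1).comp continuous_subtype_val) _)

/-- Splitting off a point in a given direction. -/
noncomputable def prodToTubeNe (hij : i ≠ j) {m : ℕ} (g : Fin m → V × V) :
    C(Punct E × Conf (contrEdges hij g) E, {x : V → E // IsTubeNe i j g x}) where
  toFun p := ⟨splitOff hij p.2.1 (shrink (contrEdges hij g) p.1.1 p.2.1 • p.1.1),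
    isTubeNe_splitOff hij p.1 p.2⟩
  continuous_toFun := by
    refine Continuous.subtype_mk ?_ _
    refine Continuous.update (continuous_pi fun v => ?_) j (Continuous.add ?_ ?_)
    · exact (continuous_apply _).comp (continuous_subtype_val.comp continuous_snd)
    · exact (continuous_apply _).comp (continuous_subtype_val.comp continuous_snd)
    · exact (continuous_shrink (contrEdges hij g)).smul
        (continuous_subtype_val.comp continuous_fst)

lemma interp_pos {t c : ℝ} (h0 : 0 ≤ t) (h1 : t ≤ 1) (hc : 0 < c) : 0 < (1 - t) * c + t := by
  rcases h0.eq_or_lt with rfl | h0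
  · simpa using hc
  · have := mul_nonneg (sub_nonneg.2 h1) hc.le
    linarith

lemma interp_le_one {t c : ℝ} (h1 : t ≤ 1) (hc : c ≤ 1) : (1 - t) * c + t ≤ 1 := by
  have := mul_le_mul_of_nonneg_left hc (sub_nonneg.2 h1)
  linarith

lemma Hmap_tubeNeToProd_bijective (Q : Type) [TopologicalSpace Q] (hij : i ≠ j) {m : ℕ}
    (g : Fin m → V × V) (n : ℕ) :
    Function.Bijective (Hmap ((ContinuousMap.id Q).prodMap (tubeNeToProd (E := E) hij g)) n) := by
  refine Hmap_prodMap_bijective Q _ (prodToTubeNe hij g) ?_ ?_ n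
  · let c : unitInterval × {x : V → E // IsTubeNe i j g x} → ℝ := fun p =>
      (1 - p.1.1) * shrink (contrEdges hij g) (tubeNeToProd hij g p.2).1.1
        (tubeNeToProd hij g p.2).2.1 + p.1.1
    have hc : Continuous c := by
      have h1 : Continuous fun p : unitInterval × {x : V → E // IsTubeNe i j g x} =>
          shrink (contrEdges hij g) (tubeNeToProd hij g p.2).1.1 (tubeNeToProd hij g p.2).2.1 :=
        (continuous_shrink (contrEdges hij g)).comp ((tubeNeToProd hij g).continuous.comp
          continuous_snd)
      fun_prop
    refine ⟨⟨⟨fun p => ⟨scale i j (c p) p.2.1, p.2.2.scale hij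
      (interp_pos p.1.2.1 p.1.2.2 (shrink_pos _ _ _))
        (interp_le_one p.1.2.2 (shrink_le_one _ _ _))⟩,
      Continuous.subtype_mk (by fun_prop) _⟩, fun x => Subtype.ext ?_, fun x => Subtype.ext ?_⟩⟩
    · have h0 : c (0, x) = shrink (contrEdges hij g) (tubeNeToProd hij g x).1.1
          (tubeNeToProd hij g x).2.1 := by
        simp [c]
      change SingularChains.scale i j (c (0, x)) x.1 = _
      rw [h0]
      exact (splitOff_restrict hij x.1 _).symm
    · have h1 : c (1, x) = 1 := by simp [c]
      change SingularChains.scale i j (c (1, x)) x.1 = _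
      rw [h1, scale_one]
      rfl
  · let c : unitInterval × Punct E × Conf (contrEdges hij g) E → ℝ := fun p =>
      (1 - p.1.1) * shrink (contrEdges hij g) p.2.1.1 p.2.2.1 + p.1.1
    have hc : Continuous c := by
      have h1 : Continuous fun p : unitInterval × Punct E × Conf (contrEdges hij g) E =>
          shrink (contrEdges hij g) p.2.1.1 p.2.2.1 :=
        (continuous_shrink (contrEdges hij g)).comp continuous_snd
      fun_prop
    refine ⟨⟨⟨fun p => (⟨c p • p.2.1.1, smul_ne_zero
      (interp_pos p.1.2.1 p.1.2.2 (shrink_pos _ _ _)).ne' p.2.1.2⟩, p.2.2),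
      (Continuous.subtype_mk (by fun_prop) _).prodMk (by fun_prop)⟩, fun x => ?_, fun x => ?_⟩⟩
    · refine Prod.ext (Subtype.ext ?_) (Subtype.ext ?_)
      · change c (0, x) • x.1.1 = splitOff hij x.2.1 _ j - splitOff hij x.2.1 _ i
        rw [splitOff_left, splitOff_right, add_sub_cancel_left]
        simp [c]
      · funext v
        exact (splitOff_of_ne hij _ _ v.2).symm
    · refine Prod.ext (Subtype.ext ?_) rfl
      change c (1, x) • x.1.1 = x.1.1
      simp [c]

end Collision

end Collisions

section Detection

variable {V : Type} {E : Type} [NormedAddCommGroup E]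

/-- The differences of the points at the ends of edges. -/
def edgeDiff {m : ℕ} (g : Fin m → V × V) : C(Conf g E, Fin m → Punct E) where
  toFun x k := ⟨x.1 (g k).2 - x.1 (g k).1, sub_ne_zero.2 (x.2 k).symm⟩
  continuous_toFun := continuous_pi fun _ =>
    Continuous.subtype_mk ((continuous_point _).sub (continuous_point _)) _

variable [NormedSpace ℝ E]

lemma contractibleSpace_conf (g : Fin 0 → V × V) : ContractibleSpace (Conf g E) :=
  contractibleSpace_subtype 0 (fun k => k.elim0) fun _ _ _ _ _ _ _ k => k.elim0

lemma isEmpty_conf_of_eq {V α : Type} {e : V × V} (h : e.1 = e.2) {m : ℕ} (g : Fin m → V × V) :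
    IsEmpty (Conf (Fin.cons e g : Fin (m + 1) → V × V) α) :=
  ⟨fun x => ((isConf_cons e g x.1).1 x.2).1 (congrArg x.1 h)⟩

lemma injective_of_comp_injective {X Y Z : Type} [TopologicalSpace X] [TopologicalSpace Y]
    [TopologicalSpace Z] (f : C(X, Y)) (g : C(Y, Z)) (n : ℕ)
    (h : Function.Injective (Hmap (g.comp f) n)) : Function.Injective (Hmap f n) := by
  intro a b hab
  apply h
  rw [Hmap_comp, Hmap_comp, hab]

lemma IsMVSquare.eq_zero_of_map_eq_zero {X W A B T T' : Type} [TopologicalSpace X]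
    [TopologicalSpace W] [TopologicalSpace A] [TopologicalSpace B] [TopologicalSpace T]
    [TopologicalSpace T'] {jA : C(W, A)} {jB : C(W, B)} {iA : C(A, X)} {iB : C(B, X)}
    (S : IsMVSquare jA jB iA iB) (f : C(A, T)) (f' : C(X, T')) {n : ℕ}
    (hf : Function.Injective (Hmap (f.comp jA) n)) (hf' : Function.Injective (Hmap f' n))
    (u : Hom n A) (h : Hmap f n u = 0) (h' : Hmap (f'.comp iA) n u = 0) : u = 0 := by
  have h2 : Hmap iA n u = 0 := hf' ((Hmap_comp _ _ _ _).symm.trans (h'.trans (map_zero _).symm))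
  obtain ⟨w, rfl, -⟩ := S.exact_middle u 0 (by rw [h2, map_zero, add_zero])
  have h3 : w = 0 := hf ((Hmap_comp _ _ _ _).trans (h.trans (map_zero _).symm))
  rw [h3, map_zero]

variable [DecidableEq V] {i j : V}

lemma isMVSquare_collision (Q : Type) [TopologicalSpace Q] (i j : V) {m : ℕ}
    (g : Fin m → V × V) :
    IsMVSquare
      (prodIncl Q (p := IsTubeNe (E := E) i j g)
        (q := IsConf (Fin.cons (i, j) g : Fin (m + 1) → V × V))
        fun x h => (isConf_cons (i, j) g x).2 ⟨h.1, h.2.isConf⟩)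
      (prodIncl Q (p := IsTubeNe (E := E) i j g) (q := IsTube i j g) fun _ h => h.2)
      (prodIncl Q (p := IsConf (α := E) (Fin.cons (i, j) g : Fin (m + 1) → V × V)) (q := IsConf g)
        fun x h => ((isConf_cons (i, j) g x).1 h).2)
      (prodIncl Q (p := IsTube (E := E) i j g) (q := IsConf g) fun _ h => h.isConf) := by
  refine isMVSquare_prod Q (isOpen_isConf _) (isOpen_isTube g) (fun x => ⟨fun h => ?_, ?_⟩)
    fun x => ?_
  · by_cases hx : x i = x j
    · refine Or.inr fun s => ?_
      rwa [scale_of_eq hx]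
    · exact Or.inl ((isConf_cons (i, j) g x).2 ⟨hx, h⟩)
  · rintro (h | h)
    · exact ((isConf_cons (i, j) g x).1 h).2
    · exact h.isConf
  · rw [isConf_cons]
    exact ⟨fun h => ⟨⟨h.1, h.2.isConf⟩, h.2⟩, fun h => ⟨h.1.1, h.2⟩⟩

/-- Separating the first coordinate. -/
def separate (Q S : Type) [TopologicalSpace Q] [TopologicalSpace S] (m : ℕ) :
    C(Q × (Fin (m + 1) → S), (Q × S) × (Fin m → S)) where
  toFun p := ((p.1, p.2 0), fun k => p.2 k.succ)
  continuous_toFun := by fun_prop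

lemma Hmap_separate_edgeDiff_injective (Q : Type) [TopologicalSpace Q] (hij : i ≠ j) {m : ℕ}
    (g : Fin m → V × V) (n : ℕ)
    (hA : Function.Injective (Hmap ((ContinuousMap.id (Q × Punct E)).prodMap
      (edgeDiff (E := E) (contrEdges hij g))) n)) :
    Function.Injective (Hmap (((separate Q (Punct E) m).comp
      ((ContinuousMap.id Q).prodMap
        (edgeDiff (E := E) (Fin.cons (i, j) g : Fin (m + 1) → V × V)))).comp
      (prodIncl Q (p := IsTubeNe (E := E) i j g)
        (q := IsConf (Fin.cons (i, j) g : Fin (m + 1) → V × V))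
        fun x h => (isConf_cons (i, j) g x).2 ⟨h.1, h.2.isConf⟩)) n) := by
  let α : C(Q × Punct E × Conf (contrEdges hij g) E, (Q × Punct E) × Conf (contrEdges hij g) E) :=
    ((Homeomorph.prodAssoc Q (Punct E) (Conf (contrEdges hij g) E)).symm : C(_, _))
  have hα : Function.Bijective (Hmap α n) := Hmap_homeomorph_bijective _ n
  have key : ContinuousMap.Homotopic
      (((ContinuousMap.id (Q × Punct E)).prodMap (edgeDiff (E := E) (contrEdges hij g))).comp
        (α.comp ((ContinuousMap.id Q).prodMap (tubeNeToProd (E := E) hij g))))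
      (((separate Q (Punct E) m).comp
      ((ContinuousMap.id Q).prodMap
        (edgeDiff (E := E) (Fin.cons (i, j) g : Fin (m + 1) → V × V)))).comp
      (prodIncl Q (p := IsTubeNe (E := E) i j g)
        (q := IsConf (Fin.cons (i, j) g : Fin (m + 1) → V × V))
        fun x h => (isConf_cons (i, j) g x).2 ⟨h.1, h.2.isConf⟩)) := by
    let σ : C(unitInterval × Q × {x : V → E // IsTubeNe i j g x}, Conf g E) :=
      ⟨fun p => ⟨scale i j p.1 p.2.2.1, p.2.2.2.2 p.1⟩, Continuous.subtype_mk (by fun_prop) _⟩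
    refine ⟨⟨⟨fun p => ((p.2.1, ⟨p.2.2.1 j - p.2.2.1 i, sub_ne_zero.2 p.2.2.2.1.symm⟩),
      edgeDiff g (σ p)), ?_⟩, fun x => ?_, fun x => ?_⟩⟩
    · refine Continuous.prodMk (Continuous.prodMk (by fun_prop) (Continuous.subtype_mk ?_ _))
        (by fun_prop)
      exact ((continuous_point j).sub (continuous_point i)).comp (by fun_prop)
    · refine Prod.ext rfl (funext fun k => Subtype.ext ?_)
      change scale i j ((0 : unitInterval) : ℝ) x.2.1 (g k).2 -
        scale i j ((0 : unitInterval) : ℝ) x.2.1 (g k).1 = _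
      rw [Set.Icc.coe_zero, scale_zero hij]
      rfl
    · refine Prod.ext rfl (funext fun k => Subtype.ext ?_)
      change scale i j ((1 : unitInterval) : ℝ) x.2.1 (g k).2 -
        scale i j ((1 : unitInterval) : ℝ) x.2.1 (g k).1 = _
      rw [Set.Icc.coe_one, scale_one]
      rfl
  rw [← Hmap_eq_of_homotopic key]
  intro a b hab
  rw [Hmap_comp, Hmap_comp _ _ _ b] at hab
  have h1 := hA hab
  rw [Hmap_comp, Hmap_comp _ _ _ b] at h1
  exact (Hmap_tubeNeToProd_bijective Q hij g n).1 (hα.1 h1)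

/-- The homology of a configuration space is detected by the differences along edges. -/
theorem Hmap_edgeDiff_injective {m : ℕ} : ∀ {V : Type} [DecidableEq V] (g : Fin m → V × V)
    (Q : Type) [TopologicalSpace Q] (n : ℕ),
    Function.Injective (Hmap ((ContinuousMap.id Q).prodMap (edgeDiff (E := E) g)) n) := by
  induction m with
  | zero =>
    intro V _ g Q _ n
    have := contractibleSpace_conf (E := E) g
    exact injective_of_comp_injective _ ContinuousMap.fst n
      (Hmap_fst_bijective Q (Conf g E) n).1
  | succ m ih =>
    intro V _ g Q _ n
    obtain ⟨e, g, rfl⟩ : ∃ e g', g = Fin.cons e g' := ⟨g 0, Fin.tail g, (Fin.cons_self_tail g).symm⟩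
    by_cases he : e.1 = e.2
    · have := isEmpty_conf_of_eq (α := E) he g
      exact Function.injective_of_subsingleton _
    obtain ⟨i, j⟩ := e
    have hij : i ≠ j := he
    have S := isMVSquare_collision (E := E) Q i j g
    rw [injective_iff_map_eq_zero]
    intro u hu
    refine S.eq_zero_of_map_eq_zero ((separate Q (Punct E) m).comp ((ContinuousMap.id Q).prodMap
      (edgeDiff (Fin.cons (i, j) g : Fin (m + 1) → V × V))))
      ((ContinuousMap.id Q).prodMap (edgeDiff g))
      (Hmap_separate_edgeDiff_injective Q hij g n (ih _ _ n)) (ih g Q n) u ?_ ?_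
    · rw [Hmap_comp, hu, map_zero]
    · let β : C(Fin (m + 1) → Punct E, Fin m → Punct E) := ⟨fun y k => y k.succ, by fun_prop⟩
      have h1 := congrArg (Hmap ((ContinuousMap.id Q).prodMap β) n) hu
      rw [← Hmap_comp, map_zero] at h1
      exact h1

lemma Hmap_collision_injective (Q : Type) [TopologicalSpace Q] (hij : i ≠ j) {m : ℕ}
    (g : Fin m → V × V) (n : ℕ) :
    Function.Injective (Hmap (prodIncl Q (p := IsTubeNe (E := E) i j g)
        (q := IsConf (Fin.cons (i, j) g : Fin (m + 1) → V × V))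
        fun x h => (isConf_cons (i, j) g x).2 ⟨h.1, h.2.isConf⟩) n) :=
  injective_of_comp_injective _ _ n
    (Hmap_separate_edgeDiff_injective Q hij g n (Hmap_edgeDiff_injective _ _ n))

end Detection

section Ranks

section Point

/-- The constant simplex. -/
noncomputable def pt (n : ℕ) : Chain n Unit := Finsupp.single (ContinuousMap.const _ ()) 1

lemma exists_eq_smul_pt {n : ℕ} (c : Chain n Unit) : ∃ a : ℤ, c = a • pt n := by
  refine ⟨c (ContinuousMap.const _ ()), ?_⟩
  ext σ
  have : σ = ContinuousMap.const _ () := ContinuousMap.ext fun _ => rfl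
  subst this
  simp [pt]

lemma smul_pt_eq_zero {n : ℕ} {a : ℤ} (h : a • pt n = 0) : a = 0 := by
  have := DFunLike.congr_fun h (ContinuousMap.const _ ())
  simpa [pt] using this

lemma bdS_pt (n : ℕ) : bdS n (pt (n + 1)) = (if Even n then (0 : ℤ) else 1) • pt n := by
  rw [pt, bdS_single]
  have h : ∀ i, face i (ContinuousMap.const (Simp (n + 1)) ()) = ContinuousMap.const (Simp n) () :=
    fun _ => rfl
  simp only [h, ← Finset.sum_smul, Fin.sum_neg_one_pow]
  rw [pt]
  congr 1
  simp [Nat.even_add]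

lemma nonempty_hom_zero_unit : Nonempty (Hom 0 Unit ≃ₗ[ℤ] ℤ) := by
  have h0 : ∀ c : Chain 0 Unit, bd 0 c = 0 := fun _ => rfl
  let f : ℤ →ₗ[ℤ] Hom 0 Unit := LinearMap.toSpanSingleton ℤ _ (cls (pt 0) (h0 _))
  have hf : ∀ a, f a = cls (a • pt 0) (h0 _) := fun a => rfl
  refine ⟨(LinearEquiv.ofBijective f ⟨?_, fun x => ?_⟩).symm⟩
  · rw [injective_iff_map_eq_zero]
    intro a ha
    rw [hf, cls_eq_zero_iff] at ha
    obtain ⟨e, he⟩ := ha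
    obtain ⟨b, rfl⟩ := exists_eq_smul_pt e
    rw [map_smul, bdS_pt, if_pos Even.zero, zero_smul, smul_zero] at he
    exact smul_pt_eq_zero he.symm
  · obtain ⟨c, hc, rfl⟩ := exists_cls x
    obtain ⟨a, rfl⟩ := exists_eq_smul_pt c
    exact ⟨a, rfl⟩

lemma subsingleton_hom_succ_unit (n : ℕ) : Subsingleton (Hom (n + 1) Unit) := by
  refine subsingleton_of_forall_eq 0 fun x => ?_
  obtain ⟨c, hc, rfl⟩ := exists_cls x
  obtain ⟨a, rfl⟩ := exists_eq_smul_pt c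
  rw [cls_eq_zero_iff]
  by_cases hn : Even n
  · refine ⟨a • pt (n + 2), ?_⟩
    rw [map_smul, bdS_pt, if_neg (Nat.not_even_iff_odd.2 hn.add_one), one_smul]
  · have h : a • pt n = 0 := by
      have h1 : bdS n (a • pt (n + 1)) = 0 := hc
      rwa [map_smul, bdS_pt, if_neg hn, one_smul] at h1
    exact ⟨0, by rw [smul_pt_eq_zero h, map_zero, zero_smul]⟩

end Point

/-- Ranks in a split short exact sequence. -/
lemma free_of_exact {M A B K : Type} [AddCommGroup M] [AddCommGroup A] [AddCommGroup B]
    [AddCommGroup K] [Module.Free ℤ M] [Module.Finite ℤ M] [Module.Free ℤ B] [Module.Finite ℤ B]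
    [Module.Free ℤ K] [Module.Finite ℤ K] (f : M →ₗ[ℤ] A × B) (g : A × B →ₗ[ℤ] K)
    (hf : Function.Injective f) (h : Function.Exact f g) (hg : Function.Surjective g) :
    (Module.Free ℤ A ∧ Module.Finite ℤ A) ∧
      Module.finrank ℤ A + Module.finrank ℤ B = Module.finrank ℤ M + Module.finrank ℤ K := by
  obtain ⟨l, hl⟩ := Module.projective_lifting_property g LinearMap.id hg
  obtain ⟨e, -⟩ := h.splitSurjectiveEquiv hf ⟨l, hl⟩
  have : Module.Finite ℤ (A × B) := Module.Finite.equiv e.symm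
  have : Module.Free ℤ (A × B) := Module.Free.of_equiv e.symm
  have hA : Module.Finite ℤ A :=
    Module.Finite.of_surjective (LinearMap.fst ℤ A B) Prod.fst_surjective
  have : Module.IsTorsionFree ℤ A :=
    (LinearMap.inl_injective (R := ℤ) (M := A) (M₂ := B)).moduleIsTorsionFree _ fun c x =>
      map_smul (LinearMap.inl ℤ A B) c x
  have hA' : Module.Free ℤ A := inferInstance
  refine ⟨⟨hA', hA⟩, ?_⟩
  rw [← Module.finrank_prod, ← Module.finrank_prod, e.finrank_eq]

lemma IsMVSquare.freeHom {X W A B : Type} [TopologicalSpace X] [TopologicalSpace W]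
    [TopologicalSpace A] [TopologicalSpace B] {jA : C(W, A)} {jB : C(W, B)} {iA : C(A, X)}
    {iB : C(B, X)} (S : IsMVSquare jA jB iA iB) (hj : ∀ n, Function.Injective (Hmap jA n))
    (hW : FreeHom W) (hB : FreeHom B) (hX : FreeHom X) :
    FreeHom A ∧ ∀ d, betti A d + betti B d = betti W d + betti X d := by
  have key : ∀ d, (Module.Free ℤ (Hom d A) ∧ Module.Finite ℤ (Hom d A)) ∧
      betti A d + betti B d = betti W d + betti X d := fun d => by
    have := (hW d).1
    have := (hW d).2
    have := (hB d).1
    have := (hB d).2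
    have := (hX d).1
    have := (hX d).2
    refine free_of_exact ((Hmap jA d).prod (-Hmap jB d)) ((Hmap iA d).coprod (Hmap iB d))
      (fun a b hab => hj d (congrArg Prod.fst hab)) ?_ fun x => ?_
    · rintro ⟨a, b⟩
      constructor
      · intro h
        obtain ⟨w, h1, h2⟩ := S.exact_middle a b h
        exact ⟨w, Prod.ext h1 (neg_eq_iff_eq_neg.2 h2)⟩
      · rintro ⟨w, hw⟩
        obtain ⟨rfl, rfl⟩ := Prod.ext_iff.1 hw
        change Hmap iA d (Hmap jA d w) + Hmap iB d (-Hmap jB d w) = 0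
        rw [S.Hmap_comm, map_neg, add_neg_cancel]
    · obtain ⟨a, b, rfl⟩ := S.surjective_of_injective hj d x
      exact ⟨(a, b), rfl⟩
  exact ⟨fun d => (key d).1, fun d => (key d).2⟩

end Ranks

section Chromatic

lemma natCard_isConf_cons {V α : Type} [Finite V] [DecidableEq V] [Finite α] {i j : V}
    (hij : i ≠ j) {m : ℕ} (g : Fin m → V × V) :
    Nat.card {f : V → α // IsConf g f} =
      Nat.card {f : V → α // IsConf (Fin.cons (i, j) g : Fin (m + 1) → V × V) f} +
      Nat.card {f : {v // v ≠ j} → α // IsConf (contrEdges hij g) f} := by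
  classical
  rw [← Nat.card_sum]
  refine Nat.card_congr
    { toFun := fun f => if h : f.1 i = f.1 j
        then Sum.inr ⟨fun v => f.1 v, by
          rw [isConf_contrEdges, comp_contr_of_eq hij h]
          exact f.2⟩
        else Sum.inl ⟨f.1, (isConf_cons (i, j) g f.1).2 ⟨h, f.2⟩⟩
      invFun := Sum.elim (fun f => ⟨f.1, ((isConf_cons (i, j) g f.1).1 f.2).2⟩)
        fun z => ⟨z.1 ∘ contr hij, z.2⟩
      left_inv := fun f => ?_
      right_inv := fun z => ?_ }
  · dsimp only
    split_ifs with h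
    · exact Subtype.ext (comp_contr_of_eq hij h)
    · rfl
  · rcases z with f | z
    · exact dif_neg ((isConf_cons (i, j) g f.1).1 f.2).1
    · have h : (z.1 ∘ contr hij) i = (z.1 ∘ contr hij) j := by
        simp only [Function.comp_apply, contr_left, contr_right]
      exact (dif_pos h).trans (congrArg Sum.inr (Subtype.ext (comp_contr_comp_val hij z.1)))

variable {E : Type} [NormedAddCommGroup E] [NormedSpace ℝ E]

lemma betti_congr {X Y : Type} [TopologicalSpace X] [TopologicalSpace Y] {d : ℕ}
    (e : Hom d X ≃ₗ[ℤ] Hom d Y) : betti X d = betti Y d :=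
  e.finrank_eq

/-- Adding an edge to a configuration space. -/
lemma FreeHom.conf_cons {V : Type} [DecidableEq V] {i j : V} (hij : i ≠ j) {m n : ℕ}
    (g : Fin m → V × V) (hE : Module.finrank ℝ E = n + 1) (hX : FreeHom (Unit × Conf g E))
    (hZ : FreeHom (Unit × Conf (contrEdges hij g) E)) :
    FreeHom (Unit × Conf (Fin.cons (i, j) g : Fin (m + 1) → V × V) E) ∧
    ∀ d, betti (Unit × Conf (Fin.cons (i, j) g : Fin (m + 1) → V × V) E) d =
      betti (Unit × Conf g E) d +
        if n ≤ d then betti (Unit × Conf (contrEdges hij g) E) (d - n) else 0 := by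
  obtain ⟨hP, hP'⟩ := hZ.prod_punct hE
  have eW : ∀ d, Nonempty (Hom d ((Unit × Conf (contrEdges hij g) E) × Punct E) ≃ₗ[ℤ]
      Hom d (Unit × {x : V → E // IsTubeNe i j g x})) := fun d =>
    ⟨(homCongr ((Homeomorph.prodAssoc _ _ _).trans
      ((Homeomorph.refl Unit).prodCongr (Homeomorph.prodComm _ _))) d).trans
      (LinearEquiv.ofBijective _ (Hmap_tubeNeToProd_bijective Unit hij g d)).symm⟩
  have eB : ∀ d, Nonempty (Hom d (Unit × Conf (contrEdges hij g) E) ≃ₗ[ℤ]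
      Hom d (Unit × {x : V → E // IsTube i j g x})) := fun d =>
    ⟨(LinearEquiv.ofBijective _ (Hmap_tubeToConf_bijective Unit hij g d)).symm⟩
  obtain ⟨hA, h⟩ := (isMVSquare_collision (E := E) Unit i j g).freeHom
    (Hmap_collision_injective Unit hij g) (hP.of_equiv eW) (hZ.of_equiv eB) hX
  refine ⟨hA, fun d => ?_⟩
  have h1 := h d
  rw [← betti_congr (eW d).some, ← betti_congr (eB d).some, hP', add_comm, add_assoc,
    add_left_cancel_iff] at h1
  exact h1.trans (add_comm _ _)

/-- The homology of a configuration space, together with its chromatic polynomial. -/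
theorem exists_chromatic {n m : ℕ} (hn : n ≠ 0) (hE : Module.finrank ℝ E = n + 1) :
    ∀ (V : Type) [Fintype V] [DecidableEq V] (g : Fin m → V × V), ∃ p : Polynomial ℤ,
    (∀ k : ℕ, p.eval (k : ℤ) = Nat.card {f : V → Fin k // IsConf g f}) ∧
    (∀ i, Fintype.card V < i → p.coeff i = 0) ∧
    FreeHom (Unit × Conf g E) ∧
    (∀ c i, c + i = Fintype.card V →
      (betti (Unit × Conf g E) (c * n) : ℤ) = (-1) ^ c * p.coeff i) ∧
    ∀ d, (∀ c ≤ Fintype.card V, d ≠ c * n) → betti (Unit × Conf g E) d = 0 := by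
  induction m with
  | zero =>
    intro V _ _ g
    have := contractibleSpace_conf (E := E) g
    have e : ∀ d, Hom d (Unit × Conf g E) ≃ₗ[ℤ] Hom d Unit := fun d =>
      LinearEquiv.ofBijective _ (Hmap_fst_bijective Unit (Conf g E) d)
    obtain ⟨e0⟩ := nonempty_hom_zero_unit
    have hpos : ∀ d, d ≠ 0 → Subsingleton (Hom d (Unit × Conf g E)) := fun d hd => by
      obtain ⟨d, rfl⟩ := Nat.exists_eq_succ_of_ne_zero hd
      have := subsingleton_hom_succ_unit d
      exact (e _).injective.subsingleton
    have hb : ∀ d, d ≠ 0 → betti (Unit × Conf g E) d = 0 := fun d hd => by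
      have := hpos d hd
      exact Module.finrank_zero_of_subsingleton
    have hb0 : betti (Unit × Conf g E) 0 = 1 :=
      (((e 0).trans e0).finrank_eq).trans (Module.finrank_self ℤ)
    refine ⟨Polynomial.X ^ Fintype.card V, fun k => ?_, fun i hi => ?_, fun d => ?_,
      fun c i hci => ?_, fun d hd => hb d fun h => ?_⟩
    · have hk : ∀ f : V → Fin k, IsConf g f := fun f l => l.elim0
      rw [Nat.card_congr (Equiv.subtypeUnivEquiv hk)]
      simp
    · rw [Polynomial.coeff_X_pow, if_neg hi.ne']
    · rcases eq_or_ne d 0 with rfl | hd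
      · exact ⟨Module.Free.of_equiv ((e 0).trans e0).symm,
          Module.Finite.equiv ((e 0).trans e0).symm⟩
      · have := hpos d hd
        exact ⟨inferInstance, inferInstance⟩
    · rcases eq_or_ne c 0 with rfl | hc
      · rw [zero_mul, hb0, Polynomial.coeff_X_pow, if_pos (by omega)]
        simp
      · rw [hb _ (mul_ne_zero hc hn), Polynomial.coeff_X_pow, if_neg (by omega)]
        simp
    · exact hd 0 (Nat.zero_le _) (by rw [h, zero_mul])
  | succ m ih =>
    intro V _ _ g
    obtain ⟨⟨i, j⟩, g, rfl⟩ : ∃ e g', g = Fin.cons e g' :=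
      ⟨g 0, Fin.tail g, (Fin.cons_self_tail g).symm⟩
    by_cases hij : i = j
    · have := isEmpty_conf_of_eq (α := E) (e := (i, j)) hij g
      have hb : ∀ d, betti (Unit × Conf (Fin.cons (i, j) g : Fin (m + 1) → V × V) E) d = 0 :=
        fun d => Module.finrank_zero_of_subsingleton
      refine ⟨0, fun k => ?_, fun _ _ => rfl, fun d => ⟨inferInstance, inferInstance⟩,
        fun c i _ => ?_, fun d _ => hb d⟩
      · have := isEmpty_conf_of_eq (α := Fin k) (e := (i, j)) hij g
        rw [Nat.card_of_isEmpty]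
        simp
      · rw [hb]
        simp
    obtain ⟨p, hp, hp', hX, hb, hb'⟩ := ih V g
    obtain ⟨q, hq, hq', hZ, hc, hc'⟩ := ih {v // v ≠ j} (contrEdges hij g)
    have hr : Fintype.card V = Fintype.card {v // v ≠ j} + 1 := by
      have := Fintype.card_pos_iff.2 ⟨j⟩
      rw [Fintype.card_subtype_compl, Fintype.card_subtype_eq]
      omega
    obtain ⟨hU, h⟩ := hX.conf_cons hij g hE hZ
    refine ⟨p - q, fun k => ?_, fun i hi => ?_, hU, fun c i hci => ?_, fun d hd => ?_⟩
    · rw [Polynomial.eval_sub, hp, hq, natCard_isConf_cons hij g]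
      push_cast
      ring
    · rw [Polynomial.coeff_sub, hp' i hi, hq' i (by omega), sub_zero]
    · rw [h, Polynomial.coeff_sub, Nat.cast_add, hb c i hci]
      rcases c with _ | c
      · rw [if_neg (by omega), hq' i (by omega)]
        simp
      · rw [if_pos (Nat.le_mul_of_pos_left _ c.succ_pos), Nat.succ_mul, Nat.add_sub_cancel,
          hc c i (by omega)]
        ring
    · rw [h, hb' d hd]
      split_ifs with hnd
      · refine (zero_add _).trans (hc' _ fun c hcr he => hd (c + 1) (by omega) ?_)
        rw [Nat.succ_mul, ← he]
        omega
      · rfl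

/-- The edges of a graph on a finite type, as a family. -/
lemma exists_isConf_iff {V : Type} [Finite V] (G : SimpleGraph V) :
    ∃ (m : ℕ) (g : Fin m → V × V), ∀ (α : Type) (x : V → α),
      IsConf g x ↔ ∀ i j, G.Adj i j → x i ≠ x j := by
  obtain ⟨m, ⟨e⟩⟩ := Finite.exists_equiv_fin {e : V × V // G.Adj e.1 e.2}
  refine ⟨m, fun k => (e.symm k).1, fun α x => ⟨fun h i j hij => ?_, fun h k => ?_⟩⟩
  · have := h (e ⟨(i, j), hij⟩)
    dsimp only at this
    rwa [e.symm_apply_apply] at this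
  · exact h _ _ (e.symm k).2

end Chromatic

end SingularChains

open SingularChains

theorem stmt0 (m N : ℕ) (hm : 1 ≤ m) (hN : 2 ≤ N)
    (G : SimpleGraph (Fin m)) (hG : G.Connected)
    (P : Polynomial ℤ)
    (hP : ∀ k : ℕ, P.eval (k : ℤ) =
      Nat.card {f : Fin m → Fin k // ∀ i j, G.Adj i j → f i ≠ f j}) :
    (∀ d : ℕ, Module.Free ℤ (SH d (chromConf N m G)) ∧
      Module.Finite ℤ (SH d (chromConf N m G))) ∧
    (∀ d : ℕ, (∀ i : ℕ, 1 ≤ i → i ≤ m → d ≠ (m - i) * (N - 1)) →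
      Subsingleton (SH d (chromConf N m G))) ∧
    (∀ i : ℕ, 1 ≤ i → i ≤ m →
      (Module.finrank ℤ (SH ((m - i) * (N - 1)) (chromConf N m G)) : ℤ) =
        (-1) ^ (m - i) * P.coeff i) := by
  obtain ⟨r, g, hg⟩ := exists_isConf_iff G
  obtain ⟨p, hp, -, hF, hb, hb'⟩ := exists_chromatic (n := N - 1)
    (E := EuclideanSpace ℝ (Fin N)) (by omega)
    (by rw [finrank_euclideanSpace_fin]; omega) (Fin m) g
  rw [Fintype.card_fin] at hb hb'
  have hPp : P = p := by
    refine Polynomial.eq_of_infinite_eval_eq P p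
      ((Set.infinite_range_of_injective Nat.cast_injective).mono ?_)
    rintro _ ⟨k, rfl⟩
    change P.eval (k : ℤ) = p.eval (k : ℤ)
    rw [hP, hp, Nat.card_congr (Equiv.subtypeEquivRight fun f => hg (Fin k) f)]
  subst hPp
  have h0 : P.coeff 0 = 0 := by
    have : Nonempty (Fin m) := ⟨⟨0, hm⟩⟩
    have h1 := hP 0
    rw [Nat.card_of_isEmpty] at h1
    rwa [Polynomial.coeff_zero_eq_eval_zero]
  let e : ∀ d, Hom d (Unit × Conf g (EuclideanSpace ℝ (Fin N))) ≃ₗ[ℤ] SH d (chromConf N m G) :=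
    fun d => (homCongr ((Homeomorph.punitProd _).trans
      ((Homeomorph.refl _).subtype fun x => hg _ x)) d).trans (shEquiv d (chromConf N m G)).symm
  have hfree : ∀ d, Module.Free ℤ (SH d (chromConf N m G)) ∧
      Module.Finite ℤ (SH d (chromConf N m G)) := fun d => by
    have := (hF d).1
    have := (hF d).2
    exact ⟨Module.Free.of_equiv (e d), Module.Finite.equiv (e d)⟩
  refine ⟨hfree, fun d hd => ?_, fun i hi him => ?_⟩
  · have := (hF d).1
    have := (hF d).2
    have h1 : betti (Unit × Conf g (EuclideanSpace ℝ (Fin N))) d = 0 := by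
      by_cases hdm : d = m * (N - 1)
      · have h2 := hb m 0 rfl
        rw [h0, mul_zero, ← hdm] at h2
        exact_mod_cast h2
      · refine hb' d fun c hc => ?_
        rcases hc.eq_or_lt with rfl | hc
        · exact hdm
        · have := hd (m - c) (by omega) (by omega)
          rwa [Nat.sub_sub_self hc.le] at this
    have := Module.finrank_eq_zero_iff_of_free ℤ (Hom d (Unit × Conf g (EuclideanSpace ℝ (Fin N))))
    have := this.1 h1
    exact (e d).symm.injective.subsingleton
  · rw [← (e _).finrank_eq]
    exact hb (m - i) i (by omega)
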